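/- arXiv:1703.09406 — 2 statements merged into one kernel-verified Lean document; each statement's English description precedes it below -/
import Mathlib

section
/- If X ⊆ ℕ, then X ≤_T 𝟎^(n) if and only if there is a computable function g : ℕ^{n+1} → ℕ such that h(·) := lim_{x_0→∞} ⋯ lim_{x_{n−1}→∞} g(x_0, …, x_{n−1}, ·) is a total function (all iterated limits exist) and h ≡_T X. -/
open scoped Classical
noncomputable section

/-! ### Oracle computability, Turing reducibility, and the Turing jump -/

/-- Codes for partial functions computable relative to an oracle `O : ℕ → ℕ`. -/
inductive OCode : Type
  | zero | succ | left | right | oracle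
  | pair (a b : OCode)
  | comp (a b : OCode)
  | prec (a b : OCode)
  | rfind' (a : OCode)

/-- Evaluation of an oracle code relative to the oracle `O`. -/
def OCode.eval (O : ℕ → ℕ) : OCode → ℕ →. ℕ
  | .zero => pure 0
  | .succ => fun n => Part.some (n + 1)
  | .left => fun n => Part.some (Nat.unpair n).1
  | .right => fun n => Part.some (Nat.unpair n).2
  | .oracle => fun n => Part.some (O n)
  | .pair cf cg => fun n => Nat.pair <$> OCode.eval O cf n <*> OCode.eval O cg n
  | .comp cf cg => fun n => OCode.eval O cg n >>= OCode.eval O cf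
  | .prec cf cg =>
      Nat.unpaired fun a n =>
        n.rec (OCode.eval O cf a) fun y IH => do
          let i ← IH
          OCode.eval O cg (Nat.pair a (Nat.pair y i))
  | .rfind' cf =>
      Nat.unpaired fun a m =>
        (Nat.rfind fun n => (fun x => x = 0) <$> OCode.eval O cf (Nat.pair a (n + m))).map (· + m)

/-- A standard surjective decoding of natural numbers as oracle codes. -/
def OCode.ofNat : ℕ → OCode
  | 0 => .zero
  | 1 => .succ
  | 2 => .left
  | 3 => .right
  | 4 => .oracle
  | (n + 5) =>
    have h1 : (n / 4).unpair.1 < n + 5 :=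
      Nat.lt_succ_of_le (le_trans (Nat.unpair_left_le _)
        (le_trans (Nat.div_le_self n 4) (Nat.le_add_right n 4)))
    have h2 : (n / 4).unpair.2 < n + 5 :=
      Nat.lt_succ_of_le (le_trans (Nat.unpair_right_le _)
        (le_trans (Nat.div_le_self n 4) (Nat.le_add_right n 4)))
    match n % 4 with
    | 0 => .pair (OCode.ofNat (n / 4).unpair.1) (OCode.ofNat (n / 4).unpair.2)
    | 1 => .comp (OCode.ofNat (n / 4).unpair.1) (OCode.ofNat (n / 4).unpair.2)
    | 2 => .prec (OCode.ofNat (n / 4).unpair.1) (OCode.ofNat (n / 4).unpair.2)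
    | _ => .rfind' (OCode.ofNat (n / 4).unpair.1)

/-- `f` is Turing reducible to the oracle `g` (for total functions on `ℕ`). -/
def TuringLE (f g : ℕ → ℕ) : Prop :=
  ∃ c : OCode, ∀ n, c.eval g n = Part.some (f n)

/-- Turing equivalence of total functions on `ℕ`. -/
def TuringEq (f g : ℕ → ℕ) : Prop := TuringLE f g ∧ TuringLE g f

/-- The Turing jump of an oracle. -/
def tjump (O : ℕ → ℕ) : ℕ → ℕ :=
  fun e => if ((OCode.ofNat e).eval O e).Dom then 1 else 0

/-- The `n`-th iterate of the Turing jump. -/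
def tjumpIter (O : ℕ → ℕ) : ℕ → ℕ → ℕ
  | 0 => O
  | n + 1 => tjump (tjumpIter O n)

/-- `𝟎^(n)`, the `n`-th jump of the computable degree. -/
def zeroN (n : ℕ) : ℕ → ℕ := tjumpIter (fun _ => 0) n

/-- `𝟎'`, the degree of the halting problem. -/
def zeroJump : ℕ → ℕ := zeroN 1

/-- The effective join `⨁ₙ F^(n)`. -/
def omegaIter (F : ℕ → ℕ) : ℕ → ℕ := fun p => tjumpIter F p.unpair.1 p.unpair.2

/-- `𝟎^(ω)`, the effective join of all `𝟎^(n)`. -/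
def zeroOmega : ℕ → ℕ := omegaIter (fun _ => 0)

/-- The effective join of two oracles. -/
def oJoin (F G : ℕ → ℕ) : ℕ → ℕ :=
  fun k => if k % 2 = 0 then F (k / 2) else G (k / 2)

/-- The characteristic function of a set of naturals. -/
def charFun (X : Set ℕ) : ℕ → ℕ := fun k => if k ∈ X then 1 else 0

/-- Kleene bracket: the `e`-th computable partial function. -/
def phi (e : ℕ) : ℕ →. ℕ := (Denumerable.ofNat Nat.Partrec.Code e).eval

/-! ### Colored graphs -/

/-- A colored graph with vertices, labels and colors drawn from `ℕ`.
`E v w` is the (finite) set of colors of edges from `v` to `w`, and `gam` is the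
allowable colors function. -/
structure ColoredGraph where
  G : Set ℕ
  L : Set ℕ
  C : Set ℕ
  V : ℕ → ℕ
  E : ℕ → ℕ → Finset ℕ
  gam : ℕ → Finset ℕ
  V_mem : ∀ v ∈ G, V v ∈ L
  E_sub : ∀ v w : ℕ, (E v w : Set ℕ) ⊆ C
  gam_sub : ∀ l ∈ L, (gam l : Set ℕ) ⊆ C
  E_allowed : ∀ v ∈ G, ∀ w ∈ G, E v w ⊆ gam (V v) ∩ gam (V w)

/-- A computable colored graph. -/
def ColoredGraph.Computable' (g : ColoredGraph) : Prop :=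
  ComputablePred (· ∈ g.G) ∧ ComputablePred (· ∈ g.L) ∧ ComputablePred (· ∈ g.C) ∧
    Computable g.V ∧
    Computable (fun p : ℕ × ℕ => Encodable.encode (g.E p.1 p.2)) ∧
    Computable (fun l => Encodable.encode (g.gam l))

/-- A colored graph is finitary if its set of labels is finite. -/
def ColoredGraph.Finitary (g : ColoredGraph) : Prop := g.L.Finite

/-- The set of vertices incident to `v`. -/
def ColoredGraph.degSet (g : ColoredGraph) (v : ℕ) : Set ℕ :=
  {w ∈ g.G | g.E v w ≠ ∅ ∨ g.E w v ≠ ∅}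

/-- `g` has finite degree if every vertex has finitely many neighbours. -/
def ColoredGraph.FiniteDegree (g : ColoredGraph) : Prop :=
  ∀ v ∈ g.G, (g.degSet v).Finite

/-- The degree function of `g` (as a total function on `ℕ`). -/
def ColoredGraph.degFun (g : ColoredGraph) : ℕ → ℕ :=
  fun v => if v ∈ g.G then (g.degSet v).ncard else 0

/-- `g` has constant (finite) degree. -/
def ColoredGraph.ConstantDegree (g : ColoredGraph) : Prop :=
  ∃ d : ℕ, ∀ v ∈ g.G, (g.degSet v).Finite ∧ (g.degSet v).ncard = d

/-- Adjacency in the underlying graph. -/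
def ColoredGraph.Adj (g : ColoredGraph) (v w : ℕ) : Prop :=
  v ∈ g.G ∧ w ∈ g.G ∧ (g.E v w ≠ ∅ ∨ g.E w v ≠ ∅)

/-- `A` is a connected subset (the vertex set of a connected subgraph) of `g`. -/
def ColoredGraph.ConnectedSubset (g : ColoredGraph) (A : Set ℕ) : Prop :=
  A ⊆ g.G ∧ ∀ v ∈ A, ∀ w ∈ A,
    Relation.ReflTransGen (fun a b => g.Adj a b ∧ a ∈ A ∧ b ∈ A) v w

/-- The 1-neighborhood of a set of vertices. -/
def ColoredGraph.nbhd (g : ColoredGraph) (A : Set ℕ) : Set ℕ :=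
  A ∪ {v ∈ g.G | ∃ a ∈ A, g.E v a ≠ ∅ ∨ g.E a v ≠ ∅}

/-- Restriction of a colored graph to the induced subgraph on `B`. -/
def ColoredGraph.restrict (g : ColoredGraph) (B : Set ℕ) : ColoredGraph :=
  { g with
    G := g.G ∩ B
    V_mem := fun v hv => g.V_mem v hv.1
    E_allowed := fun v hv w hw => g.E_allowed v hv.1 w hw.1 }

/-! ### Graph Turing machines -/

/-- A configuration assigns to each vertex a finite set of (received) colored pulses,
a displayed alphabet symbol, and a state. -/
abbrev Config := ℕ → Finset ℕ × ℕ × ℕ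

/-- A graph Turing machine. -/
structure GraphMachine where
  graph : ColoredGraph
  A : Finset ℕ
  zero_mem : 0 ∈ A
  one_mem : 1 ∈ A
  S : Set ℕ
  s : ℕ
  alpha : ℕ → Finset ℕ
  T : ℕ → Finset ℕ → ℕ → ℕ → Finset ℕ × ℕ × ℕ
  alpha_sub : ∀ l ∈ graph.L, (alpha l : Set ℕ) ⊆ S
  s_mem : ∀ l ∈ graph.L, s ∈ alpha l
  T_trivial : ∀ l c z t, (¬ c ⊆ graph.gam l ∨ t ∉ alpha l) → T l c z t = (c, z, t)
  T_compat : ∀ l c z t, t ∈ alpha l → c ⊆ graph.gam l → z ∈ A →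
    (T l c z t).1 ⊆ graph.gam l ∧ (T l c z t).2.1 ∈ A ∧ (T l c z t).2.2 ∈ alpha l
  T_init : ∀ l, T l ∅ 0 s = (∅, 0, s)

/-- A computable graph machine. -/
def GraphMachine.Computable' (M : GraphMachine) : Prop :=
  M.graph.Computable' ∧ ComputablePred (· ∈ M.S) ∧
    Computable (fun l => Encodable.encode (M.alpha l)) ∧
    Computable (fun q : ℕ × ℕ × ℕ × ℕ =>
      Encodable.encode
        (M.T q.1 ((Encodable.decode (α := Finset ℕ) q.2.1).getD ∅) q.2.2.1 q.2.2.2))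

/-- A valid configuration for `M`. -/
def GraphMachine.Valid (M : GraphMachine) (f : Config) : Prop :=
  ∀ v ∈ M.graph.G, (f v).1 ⊆ M.graph.gam (M.graph.V v) ∧
    (f v).2.2 ∈ M.alpha (M.graph.V v)

/-- The set of colored pulses received by `v` in one step from configuration `g`:
`⋃ w ∈ G, E w v ∩ (g w).1`. -/
def GraphMachine.pulses (M : GraphMachine) (g : Config) (v : ℕ) : Finset ℕ :=
  (M.graph.gam (M.graph.V v)).filter
    (fun c => ∃ w ∈ M.graph.G, c ∈ M.graph.E w v ∧ c ∈ (g w).1)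

/-- One step of the machine. -/
def GraphMachine.step (M : GraphMachine) (g : Config) : Config :=
  fun v => M.T (M.graph.V v) (M.pulses g v) (g v).2.1 (g v).2.2

/-- The run of `M` on configuration `f`: `M.run f n v = ⟨M,f⟩(v,n)`. -/
def GraphMachine.run (M : GraphMachine) (f : Config) : ℕ → Config
  | 0 => f
  | n + 1 => M.step (M.run f n)

/-- Restriction of a graph machine to the induced subgraph on `B`. -/
def GraphMachine.restrict (M : GraphMachine) (B : Set ℕ) : GraphMachine :=
  { M with graph := M.graph.restrict B }

/-- The restriction `f|_B` of a configuration (trivial data outside `B`). -/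
def restrictConfig (M : GraphMachine) (f : Config) (B : Set ℕ) : Config :=
  fun v => if v ∈ B then f v else (∅, 0, M.s)

/-- The run of `M` on `f` halts at stage `n`. -/
def GraphMachine.HaltsAt (M : GraphMachine) (f : Config) (n : ℕ) : Prop :=
  ∀ v ∈ M.graph.G, M.run f (n + 1) v = M.run f n v

/-- The run of `M` on `f` halts. -/
def GraphMachine.Halts (M : GraphMachine) (f : Config) : Prop :=
  ∃ n, M.HaltsAt f n

/-- The starting configuration determined by a display function `x`. -/
def GraphMachine.start (M : GraphMachine) (x : ℕ → ℕ) : Config :=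
  fun v => (∅, x v, M.s)

/-- `x ∈ 𝔄^{<G}`: alphabet values on `G`, zero off `G`, finite support. -/
def GraphMachine.InDom (M : GraphMachine) (x : ℕ → ℕ) : Prop :=
  (∀ v ∈ M.graph.G, x v ∈ M.A) ∧ (∀ v ∉ M.graph.G, x v = 0) ∧ {v | x v ≠ 0}.Finite

/-- The displayed symbols at the (first) halting stage of the run on `x̂`. -/
def GraphMachine.outputAt (M : GraphMachine) (x : ℕ → ℕ) : ℕ → ℕ :=
  fun v => (M.run (M.start x) (sInf {n | M.HaltsAt (M.start x) n}) v).2.1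

/-- `{M}` is total. -/
def GraphMachine.Total (M : GraphMachine) : Prop :=
  ∀ x, M.InDom x → M.Halts (M.start x)

/-- Decoding a natural number as a finitely supported function `ℕ → ℕ`. -/
def decodeFS (n : ℕ) : ℕ → ℕ := fun v => (Denumerable.ofNat (List ℕ) n).getD v 0

/-- The function `{M}` as a total function on `ℕ` (input: code of a finitely
supported display function paired with a vertex of `G`). -/
def GraphMachine.fn (M : GraphMachine) : ℕ → ℕ := fun p =>
  if M.InDom (decodeFS p.unpair.1) ∧ M.Halts (M.start (decodeFS p.unpair.1)) ∧
      p.unpair.2 ∈ M.graph.G then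
    M.outputAt (decodeFS p.unpair.1) p.unpair.2
  else 0

/-- The restriction `x|_X` (zero outside `X`). -/
def restrictTo (X : Set ℕ) (x : ℕ → ℕ) : ℕ → ℕ :=
  fun v => if v ∈ X then x v else 0

/-- `ζ : 𝔄^{<X} → 𝔄^X` is `⟨𝒢,X⟩`-computable via `M`. -/
def GraphMachine.ComputesVia (M : GraphMachine) (X : Set ℕ) (ζ : (ℕ → ℕ) → ℕ → ℕ) :
    Prop :=
  (∀ x, M.InDom x → M.Halts (M.start x)) ∧
  (∀ x y, M.InDom x → M.InDom y → restrictTo X x = restrictTo X y →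
      ∀ v ∈ M.graph.G, M.outputAt x v = M.outputAt y v) ∧
  (∀ x, M.InDom x → ∀ v ∈ M.graph.G, v ∉ X → M.outputAt x v = 0) ∧
  (∀ x, M.InDom x → ∀ v ∈ X, M.outputAt x v = ζ (restrictTo X x) v)

/-- `ζ` is `⟨𝒢,X⟩`-computable via the computable machine `M`, where `X` is an
infinite computable subset of `G`. -/
def GraphComputableVia (M : GraphMachine) (X : Set ℕ) (ζ : (ℕ → ℕ) → ℕ → ℕ) : Prop :=
  M.Computable' ∧ X.Infinite ∧ ComputablePred (· ∈ X) ∧ X ⊆ M.graph.G ∧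
    M.ComputesVia X ζ

/-- `ζ` as a total function on `ℕ`. -/
def zetaFn (M : GraphMachine) (X : Set ℕ) (ζ : (ℕ → ℕ) → ℕ → ℕ) : ℕ → ℕ := fun p =>
  if (∀ v ∈ X, decodeFS p.unpair.1 v ∈ M.A) ∧ (∀ v ∉ X, decodeFS p.unpair.1 v = 0) ∧
      p.unpair.2 ∈ X then
    ζ (decodeFS p.unpair.1) p.unpair.2
  else 0

/-- A configuration as a total function on `ℕ` (to serve as a Turing oracle). -/
def configFn (f : Config) : ℕ → ℕ := fun v => Encodable.encode (f v)

/-- The run of `M` on `f` as a total function on `ℕ`. -/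
def runFn (M : GraphMachine) (f : Config) : ℕ → ℕ := fun p =>
  if p.unpair.1 ∈ M.graph.G then Encodable.encode (M.run f p.unpair.2 p.unpair.1) else 0

/-- A function `Finset ℕ → Finset ℕ` as a total function on `ℕ`. -/
def finsetFn (Θ : Finset ℕ → Finset ℕ) : ℕ → ℕ := fun k =>
  Encodable.encode (Θ ((Encodable.decode (α := Finset ℕ) k).getD ∅))

/-- `(B i)_{i ≤ n}` is an `n`-approximation of `M` and `f` on `A`. -/
def IsApprox (M : GraphMachine) (f : Config) (n : ℕ) (B : ℕ → Set ℕ) (A : Set ℕ) :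
    Prop :=
  B 0 = A ∧ (∀ i ≤ n, B i ⊆ M.graph.G) ∧ (∀ i < n, B i ⊆ B (i + 1)) ∧
  ∀ i < n, ∀ B' : Set ℕ, B (i + 1) ⊆ B' → B' ⊆ M.graph.G →
    ∀ v ∈ B (i + 1),
      (M.restrict (B (i + 1))).run (restrictConfig M (M.run f i) (B (i + 1))) 1 v =
        (M.restrict B').run (restrictConfig M (M.run f i) B') 1 v

/-- The characteristic function of the collection `P n f` of `n`-approximations,
as a function on (codes of) pairs `(A, (B i)_{i ≤ n})` of finite sets. -/
def approxChar (M : GraphMachine) (f : Config) (n : ℕ) : ℕ → ℕ := fun k =>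
  match Encodable.decode (α := Finset ℕ × List (Finset ℕ)) k with
  | some p =>
      if p.2.length = n + 1 ∧ ↑p.1 ⊆ M.graph.G ∧
          IsApprox M f n (fun i => ↑(p.2.getD i ∅)) ↑p.1 then 1 else 0
  | none => 0

/-- `Θ` is a uniform approximation of `M`. -/
def UniformApprox (M : GraphMachine) (Θ : Finset ℕ → Finset ℕ) : Prop :=
  ∀ A : Finset ℕ, ↑A ⊆ M.graph.G →
    A ⊆ Θ A ∧ ↑(Θ A) ⊆ M.graph.G ∧
      ∀ f : Config, M.Valid f →
        IsApprox M f 1 (fun i => if i = 0 then (↑A : Set ℕ) else ↑(Θ A)) ↑A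

/-- `M` halts within `c` steps on every starting configuration supported on a
finite connected subgraph. -/
def GraphMachine.HaltsWithin (M : GraphMachine) (c : ℕ) : Prop :=
  ∀ A : Set ℕ, A.Finite → M.graph.ConnectedSubset A →
    ∀ x : ℕ → ℕ, M.InDom x → (∀ v ∉ A, x v = 0) → M.HaltsAt (M.start x) c

/-- `M` runs in linear space. -/
def GraphMachine.RunsInLinearSpace (M : GraphMachine) : Prop :=
  M.Total ∧ ∃ a b c d : ℕ,
    ∀ A : Set ℕ, A.Finite → M.graph.ConnectedSubset A →
      ∀ x : ℕ → ℕ, M.InDom x → (∀ v ∉ A, x v = 0) →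
        (M.graph.nbhd^[a * A.ncard + b] A).encard ≤ (c * A.ncard + d : ℕ) ∧
        ∀ v ∈ A, ∀ n : ℕ,
          M.run (M.start x) n v =
            (M.restrict (M.graph.nbhd^[a * A.ncard + b] A)).run
              (restrictConfig M (M.start x) (M.graph.nbhd^[a * A.ncard + b] A)) n v

/-! ### Iterated limits -/

/-- `lim_{k→∞} u k = a` for `ℕ`-valued sequences (eventual constancy). -/
def EvLim (u : ℕ → ℕ) (a : ℕ) : Prop := ∃ N, ∀ k ≥ N, u k = a

/-- `IterLim n F a`: the `n`-fold iterated limit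
`lim_{x₀→∞} ⋯ lim_{x_{n-1}→∞} F (x₀, …, x_{n-1})` exists and equals `a`. -/
def IterLim : (n : ℕ) → ((Fin n → ℕ) → ℕ) → ℕ → Prop
  | 0, F, a => F (fun i => i.elim0) = a
  | n + 1, F, a =>
      ∃ u : ℕ → ℕ, (∀ x, IterLim n (fun xs => F (Fin.cons x xs)) (u x)) ∧ EvLim u a

/-- `X` is `k`-computably enumerable (as a `{0,1}`-valued function `X : ℕ → ℕ`). -/
def KCE (X : ℕ → ℕ) (k : ℕ) : Prop :=
  ∃ g : ℕ → ℕ → ℕ, Computable₂ g ∧ (∀ n m, g n m ≤ 1) ∧ (∀ m, g 0 m = 0) ∧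
    (∀ m, ∃ N, ∀ n ≥ N, g n m = X m) ∧
    (∀ m, {l : ℕ | g l m ≠ g (l + 1) m}.encard ≤ (k : ℕ∞))


/-! ### Auxiliary lemmas -/

namespace LimLemma

open Nat.Partrec (Code)

theorem oeval_comp (O : ℕ → ℕ) (c d : OCode) (n : ℕ) :
    (OCode.comp c d).eval O n = (d.eval O n).bind (fun x => c.eval O x) := rfl

/-- Embedding of plain codes into oracle codes. -/
def emb : Code → OCode
  | .zero => .zero
  | .succ => .succ
  | .left => .left
  | .right => .right
  | .pair a b => .pair (emb a) (emb b)
  | .comp a b => .comp (emb a) (emb b)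
  | .prec a b => .prec (emb a) (emb b)
  | .rfind' a => .rfind' (emb a)

theorem emb_eval (O : ℕ → ℕ) (c : Code) : (emb c).eval O = c.eval := by
  induction c with
  | zero => rfl
  | succ => rfl
  | left => rfl
  | right => rfl
  | pair a b iha ihb => simp only [emb, OCode.eval, Code.eval, iha, ihb]; rfl
  | comp a b iha ihb => simp only [emb, OCode.eval, Code.eval, iha, ihb]; rfl
  | prec a b iha ihb => simp only [emb, OCode.eval, Code.eval, iha, ihb]; rfl
  | rfind' a iha => simp only [emb, OCode.eval, Code.eval, iha]; rfl

/-- Substitute a code for the oracle. -/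
def subst (d : OCode) : OCode → OCode
  | .zero => .zero
  | .succ => .succ
  | .left => .left
  | .right => .right
  | .oracle => d
  | .pair a b => .pair (subst d a) (subst d b)
  | .comp a b => .comp (subst d a) (subst d b)
  | .prec a b => .prec (subst d a) (subst d b)
  | .rfind' a => .rfind' (subst d a)

theorem subst_eval {f g : ℕ → ℕ} {d : OCode} (hd : ∀ n, d.eval g n = Part.some (f n))
    (c : OCode) : (subst d c).eval g = c.eval f := by
  induction c with
  | zero => rfl
  | succ => rfl
  | left => rfl
  | right => rfl
  | oracle => funext n; exact hd n
  | pair a b iha ihb => simp only [subst, OCode.eval, iha, ihb]; rfl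
  | comp a b iha ihb => simp only [subst, OCode.eval, iha, ihb]; rfl
  | prec a b iha ihb => simp only [subst, OCode.eval, iha, ihb]; rfl
  | rfind' a iha => simp only [subst, OCode.eval, iha]; rfl

theorem le_trans' {f g h : ℕ → ℕ} (h1 : TuringLE f g) (h2 : TuringLE g h) : TuringLE f h := by
  obtain ⟨c, hc⟩ := h1
  obtain ⟨d, hd⟩ := h2
  exact ⟨subst d c, fun n => by rw [subst_eval hd, hc]⟩

theorem le_refl' (f : ℕ → ℕ) : TuringLE f f := ⟨.oracle, fun _ => rfl⟩

theorem le_of_computable {f : ℕ → ℕ} (hf : Computable f) (O : ℕ → ℕ) : TuringLE f O := by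
  obtain ⟨c, hc⟩ := Code.exists_code.1 (Partrec.nat_iff.1 hf)
  exact ⟨emb c, fun n => by rw [emb_eval, hc]; rfl⟩

theorem computable_of_le_zero {f : ℕ → ℕ} (hf : TuringLE f (fun _ => 0)) : Computable f := by
  obtain ⟨c, hc⟩ := hf
  have key : ∀ c : OCode, Nat.Partrec (c.eval (fun _ => 0)) := by
    intro c
    induction c with
    | zero => exact Nat.Partrec.zero
    | succ => exact Nat.Partrec.succ
    | left => exact Nat.Partrec.left
    | right => exact Nat.Partrec.right
    | oracle => exact Nat.Partrec.zero
    | pair a b iha ihb => exact Nat.Partrec.pair iha ihb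
    | comp a b iha ihb => exact Nat.Partrec.comp iha ihb
    | prec a b iha ihb => exact Nat.Partrec.prec iha ihb
    | rfind' a iha =>
      obtain ⟨d, hd⟩ := Code.exists_code.1 iha
      refine Code.exists_code.2 ⟨.rfind' d, ?_⟩
      simp only [Code.eval, OCode.eval, hd]; rfl
  have := key c
  rw [show c.eval (fun _ => 0) = fun n => Part.some (f n) from funext hc] at this
  exact Partrec.nat_iff.2 this

theorem le_comp {f g O : ℕ → ℕ} (hf : TuringLE f O) (hg : TuringLE g O) :
    TuringLE (fun n => f (g n)) O := by
  obtain ⟨c, hc⟩ := hf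
  obtain ⟨d, hd⟩ := hg
  exact ⟨.comp c d, fun n => by
    rw [oeval_comp]
    rw [hd, Part.bind_some, hc]⟩

theorem le_pair {f g O : ℕ → ℕ} (hf : TuringLE f O) (hg : TuringLE g O) :
    TuringLE (fun n => Nat.pair (f n) (g n)) O := by
  obtain ⟨c, hc⟩ := hf
  obtain ⟨d, hd⟩ := hg
  exact ⟨.pair c d, fun n => by simp [OCode.eval, hd, hc, Seq.seq]⟩

theorem le_prec {f g O : ℕ → ℕ} (hf : TuringLE f O) (hg : TuringLE g O) :
    TuringLE (fun p => Nat.rec (motive := fun _ => ℕ) (f p.unpair.1)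
      (fun y i => g (Nat.pair p.unpair.1 (Nat.pair y i))) p.unpair.2) O := by
  obtain ⟨c, hc⟩ := hf
  obtain ⟨d, hd⟩ := hg
  refine ⟨.prec c d, fun n => ?_⟩
  simp only [OCode.eval, Nat.unpaired]
  induction n.unpair.2 with
  | zero => exact hc _
  | succ k ih => simp only [ih]; simp [hd]

/-- Search. -/
theorem exists_search {q O : ℕ → ℕ} (hq : TuringLE q O) :
    ∃ c : OCode, ∀ n, c.eval O n =
      Nat.rfind (fun k => Part.some (decide (q (Nat.pair n k) = 0))) := by
  obtain ⟨c, hc⟩ := hq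
  obtain ⟨i, hi⟩ := le_of_computable Computable.id O
  refine ⟨.comp (.rfind' c) (.pair i .zero), fun n => ?_⟩
  have h1 : (OCode.pair i .zero).eval O n = Part.some (Nat.pair n 0) := by
    have : (pure 0 : ℕ →. ℕ) n = Part.some 0 := rfl
    simp [OCode.eval, hi, Seq.seq, this]
  have : (OCode.comp (.rfind' c) (.pair i .zero)).eval O n
    = (OCode.pair i .zero).eval O n >>= (OCode.rfind' c).eval O := rfl
  rw [this, h1]
  simp [OCode.eval, hc, Part.map_id']

theorem exists_search' {q O : ℕ → ℕ} (hq : TuringLE q O) :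
    ∃ c : OCode, ∀ n, ((c.eval O n).Dom ↔ ∃ k, q (Nat.pair n k) = 0) ∧
      ∀ p ∈ c.eval O n, q (Nat.pair n p) = 0 := by
  obtain ⟨c, hc⟩ := exists_search hq
  refine ⟨c, fun n => ?_⟩
  rw [hc]
  constructor
  · constructor
    · rintro ⟨k, hk, -⟩
      exact ⟨k, by simpa using hk⟩
    · rintro ⟨k, hk⟩
      exact ⟨k, by simpa using hk, fun _ _ => trivial⟩
  · intro p hp
    have := Nat.rfind_spec hp
    simpa using this

/-- An encoding of oracle codes. -/
theorem ofNat_surj (c : OCode) : ∃ e, OCode.ofNat e = c := by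
  have h4 : ∀ a b r, r < 4 → (4 * Nat.pair a b + r) / 4 = Nat.pair a b := by omega
  have h5 : ∀ a b r, r < 4 → (4 * Nat.pair a b + r) % 4 = r := by omega
  induction c with
  | zero => exact ⟨0, by simp [OCode.ofNat]⟩
  | succ => exact ⟨1, by simp [OCode.ofNat]⟩
  | left => exact ⟨2, by simp [OCode.ofNat]⟩
  | right => exact ⟨3, by simp [OCode.ofNat]⟩
  | oracle => exact ⟨4, by simp [OCode.ofNat]⟩
  | pair a b iha ihb =>
    obtain ⟨x, hx⟩ := iha
    obtain ⟨y, hy⟩ := ihb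
    refine ⟨4 * Nat.pair x y + 5, ?_⟩
    have e4 : 4 * Nat.pair x y / 4 = Nat.pair x y := by omega
    have e5 : 4 * Nat.pair x y % 4 = 0 := by omega
    rw [OCode.ofNat, e4, e5]
    simp [hx, hy]
  | comp a b iha ihb =>
    obtain ⟨x, hx⟩ := iha
    obtain ⟨y, hy⟩ := ihb
    refine ⟨4 * Nat.pair x y + 1 + 5, ?_⟩
    rw [OCode.ofNat, h4 _ _ _ (by omega), h5 _ _ _ (by omega)]
    simp [hx, hy]
  | prec a b iha ihb =>
    obtain ⟨x, hx⟩ := iha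
    obtain ⟨y, hy⟩ := ihb
    refine ⟨4 * Nat.pair x y + 2 + 5, ?_⟩
    rw [OCode.ofNat, h4 _ _ _ (by omega), h5 _ _ _ (by omega)]
    simp [hx, hy]
  | rfind' a iha =>
    obtain ⟨x, hx⟩ := iha
    refine ⟨4 * Nat.pair x 0 + 3 + 5, ?_⟩
    rw [OCode.ofNat, h4 _ _ _ (by omega), h5 _ _ _ (by omega)]
    simp [hx]

theorem ofNat_comp (x y : ℕ) :
    OCode.ofNat (4 * Nat.pair x y + 1 + 5) = .comp (OCode.ofNat x) (OCode.ofNat y) := by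
  have h4 : (4 * Nat.pair x y + 1) / 4 = Nat.pair x y := by omega
  have h5 : (4 * Nat.pair x y + 1) % 4 = 1 := by omega
  rw [OCode.ofNat, h4, h5]
  simp

/-- Index of the constant function. -/
def constIdx (k : ℕ) : ℕ := Nat.rec 0 (fun _ i => 4 * Nat.pair 1 i + 1 + 5) k

theorem constIdx_eval (O : ℕ → ℕ) (k n : ℕ) :
    (OCode.ofNat (constIdx k)).eval O n = Part.some k := by
  induction k with
  | zero => simp [constIdx, OCode.ofNat, OCode.eval]; rfl
  | succ k ih =>
    have : constIdx (k + 1) = 4 * Nat.pair 1 (constIdx k) + 1 + 5 := rfl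
    rw [this, ofNat_comp]
    simp [OCode.eval, ih, OCode.ofNat]

theorem constIdx_prim : Primrec constIdx := by
  have : Primrec₂ (fun _ i : ℕ => 4 * Nat.pair 1 i + 1 + 5) := Primrec.to₂ <|
    Primrec.nat_add.comp (Primrec.nat_add.comp (Primrec.nat_mul.comp (Primrec.const 4)
    (Primrec₂.natPair.comp (Primrec.const 1) Primrec.snd)) (Primrec.const 1)) (Primrec.const 5)
  exact Primrec.nat_rec₁ 0 this

/-- s-m-n for the jump: the domain of an oracle code reduces to the jump. -/
theorem dom_le_jump (O : ℕ → ℕ) (d : OCode) :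
    ∃ s : ℕ → ℕ, Computable s ∧ ∀ k, tjump O (s k) = if (d.eval O k).Dom then 1 else 0 := by
  obtain ⟨e, rfl⟩ := ofNat_surj d
  refine ⟨fun k => 4 * Nat.pair e (constIdx k) + 1 + 5, ?_, fun k => ?_⟩
  · exact (Primrec.nat_add.comp (Primrec.nat_add.comp (Primrec.nat_mul.comp (Primrec.const 4)
      (Primrec₂.natPair.comp (Primrec.const e) constIdx_prim)) (Primrec.const 1))
        (Primrec.const 5)).to_comp
  · unfold tjump
    rw [ofNat_comp]
    have : (OCode.comp (OCode.ofNat e) (OCode.ofNat (constIdx k))).eval O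
        (4 * Nat.pair e (constIdx k) + 1 + 5) = (OCode.ofNat e).eval O k := by
      rw [oeval_comp]
      rw [constIdx_eval, Part.bind_some]
    rw [this]

/-- Limit lemma, easy direction. -/
theorem lim_le_jump {u h O : ℕ → ℕ} (hu : TuringLE u O)
    (hl : ∀ m, EvLim (fun x => u (Nat.pair x m)) (h m)) : TuringLE h (tjump O) := by
  -- argument is `pair (pair (pair N a) m) k`
  let q : ℕ → ℕ := fun z =>
    if u (Nat.pair (z.unpair.2 + z.unpair.1.unpair.1.unpair.1) z.unpair.1.unpair.2)
      = z.unpair.1.unpair.1.unpair.2 then 1 else 0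
  have hq : TuringLE q O := by
    have hG : Computable (fun z : ℕ =>
        Nat.pair (z.unpair.2 + z.unpair.1.unpair.1.unpair.1) z.unpair.1.unpair.2) := by
      have p1 : Primrec (fun z : ℕ => z.unpair.1) := Primrec.fst.comp Primrec.unpair
      have p2 : Primrec (fun z : ℕ => z.unpair.2) := Primrec.snd.comp Primrec.unpair
      exact (Primrec₂.natPair.comp (Primrec.nat_add.comp p2 (p1.comp (p1.comp p1)))
        (p2.comp p1)).to_comp
    have hF : Computable (fun w : ℕ =>
        if w.unpair.1 = w.unpair.2.unpair.1.unpair.1.unpair.2 then 1 else 0) := by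
      have p1 : Primrec (fun z : ℕ => z.unpair.1) := Primrec.fst.comp Primrec.unpair
      have p2 : Primrec (fun z : ℕ => z.unpair.2) := Primrec.snd.comp Primrec.unpair
      exact (Primrec.ite (Primrec.eq.comp p1 (p2.comp (p1.comp (p1.comp p2))))
        (Primrec.const 1) (Primrec.const 0)).to_comp
    have := le_comp (le_of_computable hF O)
      (le_pair (le_comp hu (le_of_computable hG O)) (le_of_computable Computable.id O))
    simpa [q] using this
  obtain ⟨d, hd⟩ := exists_search' hq
  obtain ⟨s, hs, hs'⟩ := dom_le_jump O d
  have hJ : ∀ N a m, tjump O (s (Nat.pair (Nat.pair N a) m)) = 0 ↔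
      ∀ k ≥ N, u (Nat.pair k m) = a := by
    intro N a m
    rw [hs', (hd _).1]
    simp only [q, Nat.unpair_pair]
    constructor
    · intro hh k hk
      by_contra hne
      rw [if_pos ⟨k - N, by rw [Nat.sub_add_cancel hk]; simp [hne]⟩] at hh
      exact one_ne_zero hh
    · intro hh
      rw [if_neg]
      rintro ⟨k, hk⟩
      rw [if_pos (hh _ (Nat.le_add_left _ _))] at hk
      exact one_ne_zero hk
  let q2 : ℕ → ℕ := fun z => tjump O (s (Nat.pair z.unpair.2 z.unpair.1))
  have hq2 : TuringLE q2 (tjump O) := by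
    refine le_comp (le_refl' _) (le_comp (le_of_computable hs _) (le_of_computable ?_ _))
    exact (Primrec₂.natPair.comp (Primrec.snd.comp Primrec.unpair)
      (Primrec.fst.comp Primrec.unpair)).to_comp
  obtain ⟨d2, hd2⟩ := exists_search' hq2
  refine ⟨.comp .right d2, fun m => ?_⟩
  obtain ⟨N, hN⟩ := hl m
  have hdom : (d2.eval (tjump O) m).Dom := by
    rw [(hd2 m).1]
    refine ⟨Nat.pair N (h m), ?_⟩
    simp only [q2, Nat.unpair_pair]
    exact (hJ _ _ _).2 hN
  obtain ⟨p, hp⟩ := Part.dom_iff_mem.1 hdom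
  have := (hd2 m).2 p hp
  simp only [q2, Nat.unpair_pair] at this
  rw [← Nat.pair_unpair p, hJ] at this
  have heq : p.unpair.2 = h m := by
    rw [← this (max N p.unpair.1) (le_max_right _ _)]
    exact hN _ (le_max_left _ _)
  rw [oeval_comp]
  rw [Part.eq_some_iff.2 hp, Part.bind_some]
  simp only [OCode.eval, heq]

theorem mem_ocomp {O : ℕ → ℕ} {c d : OCode} {n a : ℕ} :
    a ∈ (OCode.comp c d).eval O n ↔ ∃ b ∈ d.eval O n, a ∈ c.eval O b := by
  rw [oeval_comp, Part.mem_bind_iff]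

theorem mem_ccomp {c d : Code} {n a : ℕ} :
    a ∈ (Code.comp c d).eval n ↔ ∃ b ∈ d.eval n, a ∈ c.eval b := by
  rw [show (Code.comp c d).eval n = (d.eval n).bind (fun x => c.eval x) from rfl,
    Part.mem_bind_iff]

theorem mem_seq {p q : Part ℕ} {a : ℕ} :
    a ∈ (Nat.pair <$> p <*> q) ↔ ∃ x ∈ p, ∃ y ∈ q, Nat.pair x y = a := by
  simp [Seq.seq]

theorem mem_opair {O : ℕ → ℕ} {c d : OCode} {n a : ℕ} :
    a ∈ (OCode.pair c d).eval O n ↔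
      ∃ x ∈ c.eval O n, ∃ y ∈ d.eval O n, Nat.pair x y = a := mem_seq

theorem mem_cpair {c d : Code} {n a : ℕ} :
    a ∈ (Code.pair c d).eval n ↔
      ∃ x ∈ c.eval n, ∃ y ∈ d.eval n, Nat.pair x y = a := mem_seq

theorem mem_oprec_zero {O : ℕ → ℕ} {c d : OCode} {x a : ℕ} :
    a ∈ (OCode.prec c d).eval O (Nat.pair x 0) ↔ a ∈ c.eval O x := by
  simp only [OCode.eval, Nat.unpaired, Nat.unpair_pair]
  exact Iff.rfl

theorem mem_oprec_succ {O : ℕ → ℕ} {c d : OCode} {x k a : ℕ} :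
    a ∈ (OCode.prec c d).eval O (Nat.pair x (k + 1)) ↔
      ∃ i ∈ (OCode.prec c d).eval O (Nat.pair x k),
        a ∈ d.eval O (Nat.pair x (Nat.pair k i)) := by
  simp only [OCode.eval, Nat.unpaired, Nat.unpair_pair]
  exact Part.mem_bind_iff

theorem mem_cprec_zero {c d : Code} {x a : ℕ} :
    a ∈ (Code.prec c d).eval (Nat.pair x 0) ↔ a ∈ c.eval x := by
  rw [Code.eval_prec_zero]

theorem mem_cprec_succ {c d : Code} {x k a : ℕ} :
    a ∈ (Code.prec c d).eval (Nat.pair x (k + 1)) ↔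
      ∃ i ∈ (Code.prec c d).eval (Nat.pair x k),
        a ∈ d.eval (Nat.pair x (Nat.pair k i)) := by
  simp only [Code.eval, Nat.unpaired, Nat.unpair_pair]
  exact Part.mem_bind_iff

theorem mem_rf {F : ℕ → Part ℕ} {m a : ℕ} :
    a ∈ (Nat.rfind fun n => (fun x => decide (x = 0)) <$> F n).map (· + m) ↔
      ∃ k, k + m = a ∧ 0 ∈ F k ∧ ∀ j < k, ∃ y ∈ F j, y ≠ 0 := by
  rw [Part.mem_map_iff]
  constructor
  · rintro ⟨k, hk, rfl⟩
    have hk := Nat.mem_rfind.1 hk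
    refine ⟨k, rfl, ?_, fun j hj => ?_⟩
    · simpa using hk.1
    · simpa using hk.2 hj
  · rintro ⟨k, rfl, h0, h1⟩
    refine ⟨k, Nat.mem_rfind.2 ⟨by simpa using h0, fun {j} hj => ?_⟩, rfl⟩
    simpa using h1 j hj

theorem mem_orf {O : ℕ → ℕ} {c : OCode} {x m a : ℕ} :
    a ∈ (OCode.rfind' c).eval O (Nat.pair x m) ↔
      ∃ k, k + m = a ∧ 0 ∈ c.eval O (Nat.pair x (k + m)) ∧
        ∀ j < k, ∃ y ∈ c.eval O (Nat.pair x (j + m)), y ≠ 0 := by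
  simp only [OCode.eval, Nat.unpaired, Nat.unpair_pair]
  exact mem_rf (F := fun n => c.eval O (Nat.pair x (n + m)))

theorem mem_crf {c : Code} {x m a : ℕ} :
    a ∈ (Code.rfind' c).eval (Nat.pair x m) ↔
      ∃ k, k + m = a ∧ 0 ∈ c.eval (Nat.pair x (k + m)) ∧
        ∀ j < k, ∃ y ∈ c.eval (Nat.pair x (j + m)), y ≠ 0 := by
  simp only [Code.eval, Nat.unpaired, Nat.unpair_pair]
  exact mem_rf (F := fun n => c.eval (Nat.pair x (n + m)))

theorem exists_code_tot {F : ℕ → ℕ} (hF : Computable F) :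
    ∃ c : Code, ∀ n, c.eval n = Part.some (F n) := by
  obtain ⟨c, hc⟩ := Code.exists_code.1 (Partrec.nat_iff.1 hF)
  exact ⟨c, fun n => by rw [hc]; rfl⟩

theorem pu1 : Primrec (fun z : ℕ => z.unpair.1) := Primrec.fst.comp Primrec.unpair
theorem pu2 : Primrec (fun z : ℕ => z.unpair.2) := Primrec.snd.comp Primrec.unpair

/-- Left-associate a nested pair. -/
theorem exists_assocL : ∃ c : Code, ∀ x y z,
    c.eval (Nat.pair x (Nat.pair y z)) = Part.some (Nat.pair (Nat.pair x y) z) := by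
  obtain ⟨c, hc⟩ := exists_code_tot (Primrec₂.natPair.comp
    (Primrec₂.natPair.comp pu1 (pu1.comp pu2)) (pu2.comp pu2)).to_comp
  exact ⟨c, fun x y z => by rw [hc]; simp⟩

theorem exists_assocR : ∃ c : Code, ∀ x y z,
    c.eval (Nat.pair (Nat.pair x y) z) = Part.some (Nat.pair x (Nat.pair y z)) := by
  obtain ⟨c, hc⟩ := exists_code_tot (Primrec₂.natPair.comp
    (pu1.comp pu1) (Primrec₂.natPair.comp (pu2.comp pu1) pu2)).to_comp
  exact ⟨c, fun x y z => by rw [hc]; simp⟩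

/-- Lookup in a coded list. -/
theorem exists_lookup : ∃ c : Code, ∀ (σ : List ℕ) (i : ℕ),
    c.eval (Nat.pair (Encodable.encode σ) i) = (σ[i]? : Part ℕ) := by
  have h : Computable (fun z : ℕ => (Denumerable.ofNat (List ℕ) z.unpair.1)[z.unpair.2]?) :=
    (Primrec.list_getElem?.comp ((Primrec.ofNat (List ℕ)).comp pu1) pu2).to_comp
  obtain ⟨c, hc⟩ := Code.exists_code.1 (Partrec.nat_iff.1 h.ofOption)
  refine ⟨c, fun σ i => ?_⟩
  rw [hc]
  simp

/-- Left association code. -/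
def aL : Code := Classical.choose exists_assocL
/-- Right association code. -/
def aR : Code := Classical.choose exists_assocR
/-- Lookup code. -/
def lk : Code := Classical.choose exists_lookup

theorem aL_eval (x y z : ℕ) :
    aL.eval (Nat.pair x (Nat.pair y z)) = Part.some (Nat.pair (Nat.pair x y) z) :=
  Classical.choose_spec exists_assocL x y z
theorem aR_eval (x y z : ℕ) :
    aR.eval (Nat.pair (Nat.pair x y) z) = Part.some (Nat.pair x (Nat.pair y z)) :=
  Classical.choose_spec exists_assocR x y z
theorem lk_eval (σ : List ℕ) (i : ℕ) :
    lk.eval (Nat.pair (Encodable.encode σ) i) = (σ[i]? : Part ℕ) :=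
  Classical.choose_spec exists_lookup σ i

/-- Translation of oracle codes to codes taking a finite oracle as part of the input. -/
def tr : OCode → Code
  | .zero => .zero
  | .succ => .comp .succ .right
  | .left => .comp .left .right
  | .right => .comp .right .right
  | .oracle => lk
  | .pair a b => .pair (tr a) (tr b)
  | .comp a b => .comp (tr a) (.pair .left (tr b))
  | .prec a b => .comp (.prec (tr a) (.comp (tr b) aR)) aL
  | .rfind' a => .comp (.rfind' (.comp (tr a) aR)) aL

theorem mem_cleft {n a : ℕ} : a ∈ Code.left.eval n ↔ a = n.unpair.1 := Part.mem_some_iff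
theorem mem_cright {n a : ℕ} : a ∈ Code.right.eval n ↔ a = n.unpair.2 := Part.mem_some_iff
theorem mem_csucc {n a : ℕ} : a ∈ Code.succ.eval n ↔ a = n + 1 := Part.mem_some_iff
theorem mem_czero {n a : ℕ} : a ∈ Code.zero.eval n ↔ a = 0 := Part.mem_some_iff
theorem mem_oleft {O : ℕ → ℕ} {n a : ℕ} : a ∈ OCode.left.eval O n ↔ a = n.unpair.1 :=
  Part.mem_some_iff
theorem mem_oright {O : ℕ → ℕ} {n a : ℕ} : a ∈ OCode.right.eval O n ↔ a = n.unpair.2 :=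
  Part.mem_some_iff
theorem mem_osucc {O : ℕ → ℕ} {n a : ℕ} : a ∈ OCode.succ.eval O n ↔ a = n + 1 :=
  Part.mem_some_iff
theorem mem_ozero {O : ℕ → ℕ} {n a : ℕ} : a ∈ OCode.zero.eval O n ↔ a = 0 := Part.mem_some_iff
theorem mem_ooracle {O : ℕ → ℕ} {n a : ℕ} : a ∈ OCode.oracle.eval O n ↔ a = O n :=
  Part.mem_some_iff

theorem mem_compR {c : Code} {x y z a : ℕ} :
    a ∈ (Code.comp c aR).eval (Nat.pair (Nat.pair x y) z) ↔
      a ∈ c.eval (Nat.pair x (Nat.pair y z)) := by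
  simp [mem_ccomp, aR_eval]

theorem mem_compL {c : Code} {x y z a : ℕ} :
    a ∈ (Code.comp c aL).eval (Nat.pair x (Nat.pair y z)) ↔
      a ∈ c.eval (Nat.pair (Nat.pair x y) z) := by
  simp [mem_ccomp, aL_eval]

theorem mem_tcomp {a b : OCode} {s n x : ℕ} :
    x ∈ (tr (.comp a b)).eval (Nat.pair s n) ↔
      ∃ y ∈ (tr b).eval (Nat.pair s n), x ∈ (tr a).eval (Nat.pair s y) := by
  simp only [tr, mem_ccomp, mem_cpair, mem_cleft, Nat.unpair_pair]
  constructor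
  · rintro ⟨_, ⟨_, rfl, y, hy, rfl⟩, h⟩
    exact ⟨y, hy, h⟩
  · rintro ⟨y, hy, h⟩
    exact ⟨_, ⟨_, rfl, y, hy, rfl⟩, h⟩

/-- The initial segment of an oracle. -/
def seg (O : ℕ → ℕ) (L : ℕ) : List ℕ := (List.range L).map O

theorem seg_get (O : ℕ → ℕ) (L i a : ℕ) : (seg O L)[i]? = some a ↔ i < L ∧ a = O i := by
  by_cases h : i < L <;> simp [seg, h, eq_comm]

theorem tr_sound (O : ℕ → ℕ) (L : ℕ) (c : OCode) : ∀ n a,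
    a ∈ (tr c).eval (Nat.pair (Encodable.encode (seg O L)) n) → a ∈ c.eval O n := by
  induction c with
  | zero => intro n a h; rw [tr, mem_czero] at h; exact mem_ozero.2 h
  | succ => intro n a h; simpa [tr, mem_ccomp, mem_csucc, mem_cright, mem_osucc] using h
  | left => intro n a h; simpa [tr, mem_ccomp, mem_cleft, mem_cright, mem_oleft] using h
  | right => intro n a h; simpa [tr, mem_ccomp, mem_cright, mem_oright] using h
  | oracle =>
    intro n a h
    rw [tr, lk_eval, Part.mem_ofOption] at h
    exact mem_ooracle.2 ((seg_get _ _ _ _).1 h).2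
  | pair c d ihc ihd =>
    intro n a h
    obtain ⟨x, hx, y, hy, rfl⟩ := mem_cpair.1 h
    exact mem_opair.2 ⟨x, ihc _ _ hx, y, ihd _ _ hy, rfl⟩
  | comp c d ihc ihd =>
    intro n a h
    obtain ⟨x, hx, h⟩ := mem_tcomp.1 h
    exact mem_ocomp.2 ⟨x, ihd _ _ hx, ihc _ _ h⟩
  | prec c d ihc ihd =>
    intro n
    rw [← Nat.pair_unpair n]
    generalize n.unpair.1 = x
    generalize n.unpair.2 = k
    simp only [tr, mem_compL]
    induction k with
    | zero => intro a h; exact mem_oprec_zero.2 (ihc _ _ (mem_cprec_zero.1 h))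
    | succ k ih =>
      intro a h
      obtain ⟨i, hi, h⟩ := mem_cprec_succ.1 h
      exact mem_oprec_succ.2 ⟨i, ih _ hi, ihd _ _ (mem_compR.1 h)⟩
  | rfind' c ihc =>
    intro n
    rw [← Nat.pair_unpair n]
    generalize n.unpair.1 = x
    generalize n.unpair.2 = m
    simp only [tr, mem_compL]
    intro a h
    obtain ⟨k, rfl, h0, h1⟩ := mem_crf.1 h
    refine mem_orf.2 ⟨k, rfl, ihc _ _ (mem_compR.1 h0), fun j hj => ?_⟩
    obtain ⟨y, hy, hne⟩ := h1 j hj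
    exact ⟨y, ihc _ _ (mem_compR.1 hy), hne⟩

theorem tr_complete (O : ℕ → ℕ) (c : OCode) : ∀ n a, a ∈ c.eval O n →
    ∃ L, ∀ L' ≥ L, a ∈ (tr c).eval (Nat.pair (Encodable.encode (seg O L')) n) := by
  induction c with
  | zero => intro n a h; exact ⟨0, fun _ _ => mem_czero.2 (mem_ozero.1 h)⟩
  | succ =>
    intro n a h
    exact ⟨0, fun _ _ => by simpa [tr, mem_ccomp, mem_csucc, mem_cright, mem_osucc] using h⟩
  | left =>
    intro n a h
    exact ⟨0, fun _ _ => by simpa [tr, mem_ccomp, mem_cleft, mem_cright, mem_oleft] using h⟩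
  | right =>
    intro n a h
    exact ⟨0, fun _ _ => by simpa [tr, mem_ccomp, mem_cright, mem_oright] using h⟩
  | oracle =>
    intro n a h
    refine ⟨n + 1, fun L' hL => ?_⟩
    rw [tr, lk_eval, Part.mem_ofOption]
    exact (seg_get _ _ _ _).2 ⟨hL, mem_ooracle.1 h⟩
  | pair c d ihc ihd =>
    intro n a h
    obtain ⟨x, hx, y, hy, rfl⟩ := mem_opair.1 h
    obtain ⟨L1, h1⟩ := ihc _ _ hx
    obtain ⟨L2, h2⟩ := ihd _ _ hy
    exact ⟨max L1 L2, fun L' hL => mem_cpair.2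
      ⟨x, h1 _ (le_of_max_le_left hL), y, h2 _ (le_of_max_le_right hL), rfl⟩⟩
  | comp c d ihc ihd =>
    intro n a h
    obtain ⟨x, hx, h⟩ := mem_ocomp.1 h
    obtain ⟨L1, h1⟩ := ihd _ _ hx
    obtain ⟨L2, h2⟩ := ihc _ _ h
    exact ⟨max L1 L2, fun L' hL => mem_tcomp.2
      ⟨x, h1 _ (le_of_max_le_left hL), h2 _ (le_of_max_le_right hL)⟩⟩
  | prec c d ihc ihd =>
    intro n
    rw [← Nat.pair_unpair n]
    generalize n.unpair.1 = x
    generalize n.unpair.2 = k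
    simp only [tr, mem_compL]
    induction k with
    | zero =>
      intro a h
      obtain ⟨L, hL⟩ := ihc _ _ (mem_oprec_zero.1 h)
      exact ⟨L, fun L' h' => mem_cprec_zero.2 (hL _ h')⟩
    | succ k ih =>
      intro a h
      obtain ⟨i, hi, h⟩ := mem_oprec_succ.1 h
      obtain ⟨L1, h1⟩ := ih _ hi
      obtain ⟨L2, h2⟩ := ihd _ _ h
      exact ⟨max L1 L2, fun L' hL => mem_cprec_succ.2
        ⟨i, h1 _ (le_of_max_le_left hL), mem_compR.2 (h2 _ (le_of_max_le_right hL))⟩⟩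
  | rfind' c ihc =>
    intro n
    rw [← Nat.pair_unpair n]
    generalize n.unpair.1 = x
    generalize n.unpair.2 = m
    simp only [tr, mem_compL]
    intro a h
    obtain ⟨k, rfl, h0, h1⟩ := mem_orf.1 h
    obtain ⟨L0, hL0⟩ := ihc _ _ h0
    have h2 : ∀ j, ∃ L, j < k → ∀ L' ≥ L, ∃ y ∈
        (tr c).eval (Nat.pair (Encodable.encode (seg O L')) (Nat.pair x (j + m))), y ≠ 0 := by
      intro j
      by_cases hj : j < k
      · obtain ⟨y, hy, hne⟩ := h1 j hj
        obtain ⟨L, hL⟩ := ihc _ _ hy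
        exact ⟨L, fun _ L' h' => ⟨y, hL _ h', hne⟩⟩
      · exact ⟨0, fun h => absurd h hj⟩
    choose f hf using h2
    refine ⟨max L0 ((Finset.range k).sup f), fun L' hL => mem_crf.2 ⟨k, rfl,
      mem_compR.2 (hL0 _ (le_of_max_le_left hL)), fun j hj => ?_⟩⟩
    obtain ⟨y, hy, hne⟩ := hf j hj L'
      (le_trans (Finset.le_sup (Finset.mem_range.2 hj)) (le_of_max_le_right hL))
    exact ⟨y, mem_compR.2 hy, hne⟩

/-- Computability of the translation on indices. -/
theorem tr_prim : Primrec (fun e => tr (OCode.ofNat e)) := by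
  let B : ℕ → Code → Code → Code := fun n a b =>
    if n % 4 = 0 then .pair a b
    else if n % 4 = 1 then .comp a (.pair .left b)
    else if n % 4 = 2 then .comp (.prec a (.comp b aR)) aL
    else .comp (.rfind' (.comp a aR)) aL
  have hB : Primrec (fun p : ℕ × Code × Code => B p.1 p.2.1 p.2.2) := by
    have hm : Primrec (fun p : ℕ × Code × Code => p.1 % 4) :=
      Primrec.nat_mod.comp Primrec.fst (Primrec.const 4)
    have ha : Primrec (fun p : ℕ × Code × Code => p.2.1) := Primrec.fst.comp Primrec.snd
    have hb : Primrec (fun p : ℕ × Code × Code => p.2.2) := Primrec.snd.comp Primrec.snd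
    refine Primrec.ite (Primrec.eq.comp hm (Primrec.const 0))
      (Code.primrec₂_pair.comp ha hb) ?_
    refine Primrec.ite (Primrec.eq.comp hm (Primrec.const 1))
      (Code.primrec₂_comp.comp ha (Code.primrec₂_pair.comp (Primrec.const _) hb)) ?_
    refine Primrec.ite (Primrec.eq.comp hm (Primrec.const 2))
      (Code.primrec₂_comp.comp (Code.primrec₂_prec.comp ha
        (Code.primrec₂_comp.comp hb (Primrec.const _))) (Primrec.const _)) ?_
    exact Code.primrec₂_comp.comp (Code.primrec_rfind'.comp
        (Code.primrec₂_comp.comp ha (Primrec.const _))) (Primrec.const _)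
  let G : List Code → Option Code := fun l =>
    if l.length = 0 then some (tr .zero)
    else if l.length = 1 then some (tr .succ)
    else if l.length = 2 then some (tr .left)
    else if l.length = 3 then some (tr .right)
    else if l.length = 4 then some (tr .oracle)
    else (l[((l.length - 5) / 4).unpair.1]?).bind fun a =>
      (l[((l.length - 5) / 4).unpair.2]?).map fun b => B (l.length - 5) a b
  have hG : Primrec G := by
    have hlen : Primrec (fun l : List Code => l.length) := Primrec.list_length
    have hsub : Primrec (fun l : List Code => l.length - 5) :=
      Primrec.nat_sub.comp hlen (Primrec.const 5)
    have hn : Primrec (fun l : List Code => ((l.length - 5) / 4).unpair) :=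
      Primrec.unpair.comp (Primrec.nat_div.comp hsub (Primrec.const 4))
    refine Primrec.ite (Primrec.eq.comp hlen (Primrec.const 0)) (Primrec.const _) ?_
    refine Primrec.ite (Primrec.eq.comp hlen (Primrec.const 1)) (Primrec.const _) ?_
    refine Primrec.ite (Primrec.eq.comp hlen (Primrec.const 2)) (Primrec.const _) ?_
    refine Primrec.ite (Primrec.eq.comp hlen (Primrec.const 3)) (Primrec.const _) ?_
    refine Primrec.ite (Primrec.eq.comp hlen (Primrec.const 4)) (Primrec.const _) ?_
    have h2 : Primrec (fun p : (List Code × Code) × Code => B (p.1.1.length - 5) p.1.2 p.2) :=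
      hB.comp (Primrec.pair (hsub.comp (Primrec.fst.comp Primrec.fst))
        (Primrec.pair (Primrec.snd.comp Primrec.fst) Primrec.snd))
    have h1 : Primrec (fun p : List Code × Code =>
        (p.1[((p.1.length - 5) / 4).unpair.2]?).map fun b => B (p.1.length - 5) p.2 b) :=
      Primrec.option_map (Primrec.list_getElem?.comp Primrec.fst
        (Primrec.snd.comp (hn.comp Primrec.fst))) h2.to₂
    exact Primrec.option_bind (Primrec.list_getElem?.comp Primrec.id (Primrec.fst.comp hn))
      h1.to₂
  have := Primrec.nat_strong_rec (fun (_ : Unit) e => tr (OCode.ofNat e))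
    (g := fun _ l => G l) (hG.comp Primrec.snd).to₂ ?_
  · exact this.comp (Primrec.const ()) Primrec.id
  · intro _ n
    match n with
    | 0 => simp [G, OCode.ofNat]
    | 1 => simp [G, OCode.ofNat]
    | 2 => simp [G, OCode.ofNat]
    | 3 => simp [G, OCode.ofNat]
    | 4 => simp [G, OCode.ofNat]
    | n + 5 =>
      have h1 : (n / 4).unpair.1 < n + 5 :=
        Nat.lt_succ_of_le (le_trans (Nat.unpair_left_le _)
          (le_trans (Nat.div_le_self n 4) (Nat.le_add_right n 4)))
      have h2 : (n / 4).unpair.2 < n + 5 :=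
        Nat.lt_succ_of_le (le_trans (Nat.unpair_right_le _)
          (le_trans (Nat.div_le_self n 4) (Nat.le_add_right n 4)))
      rw [OCode.ofNat]
      have h4 : n % 4 < 4 := Nat.mod_lt _ (by norm_num)
      simp only [G, B, List.length_map, List.length_range, List.getElem?_map,
        Nat.add_sub_cancel, List.getElem?_range h1, List.getElem?_range h2,
        Option.map_some, Option.bind_some]
      rw [if_neg (by omega), if_neg (by omega), if_neg (by omega), if_neg (by omega),
        if_neg (by omega)]
      generalize n % 4 = r at h4
      interval_cases r <;> simp [tr]

/-- Bounded evaluations over a list of finite oracles. -/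
def runs (s : ℕ) (c : Code) (S : List (List ℕ)) (m : ℕ) : List ℕ :=
  S.filterMap fun σ => Code.evaln s c (Nat.pair (Encodable.encode σ) m)

theorem runs_prim : Primrec (fun p : ℕ × Code × List (List ℕ) × ℕ =>
    runs p.1 p.2.1 p.2.2.1 p.2.2.2) := by
  have h : Primrec (fun q : (ℕ × Code × List (List ℕ) × ℕ) × List ℕ =>
      Code.evaln q.1.1 q.1.2.1 (Nat.pair (Encodable.encode q.2) q.1.2.2.2)) :=
    Code.primrec_evaln.comp (Primrec.pair (Primrec.pair (Primrec.fst.comp Primrec.fst)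
      (Primrec.fst.comp (Primrec.snd.comp Primrec.fst)))
      (Primrec₂.natPair.comp (Primrec.encode.comp Primrec.snd)
        (Primrec.snd.comp (Primrec.snd.comp (Primrec.snd.comp Primrec.fst)))))
  exact Primrec.listFilterMap
    (Primrec.fst.comp (Primrec.snd.comp Primrec.snd)) h.to₂

/-- Approximation to the jump from a finite part of the oracle. -/
def japp (τ : List ℕ) (e : ℕ) : ℕ :=
  if (runs τ.length (tr (OCode.ofNat e)) ((List.range τ.length).map fun L => τ.take L) e).length = 0
    then 0 else 1

theorem japp_prim : Primrec₂ japp := by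
  have h1 : Primrec (fun p : List ℕ × ℕ => p.1.length) := Primrec.list_length.comp Primrec.fst
  have h2 : Primrec (fun p : List ℕ × ℕ => (List.range p.1.length).map fun L => p.1.take L) :=
    Primrec.list_map (Primrec.list_range.comp h1)
      (Primrec.list_take.comp Primrec.snd (Primrec.fst.comp Primrec.fst)).to₂
  exact Primrec.ite (Primrec.eq.comp (Primrec.list_length.comp (runs_prim.comp
    (Primrec.pair h1 (Primrec.pair (tr_prim.comp Primrec.snd) (Primrec.pair h2 Primrec.snd)))))
      (Primrec.const 0)) (Primrec.const 0) (Primrec.const 1)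

/-- Approximation to a function computable in the jump. -/
def uapp (c : Code) (τ : List ℕ) (m : ℕ) : ℕ :=
  (runs τ.length c ((List.range τ.length).map fun L => seg (japp τ) L) m).headI

theorem uapp_prim (c : Code) : Primrec₂ (uapp c) := by
  have h1 : Primrec (fun p : List ℕ × ℕ => p.1.length) := Primrec.list_length.comp Primrec.fst
  have h3 : Primrec (fun p : (List ℕ × ℕ) × ℕ => seg (japp p.1.1) p.2) :=
    Primrec.list_map (Primrec.list_range.comp Primrec.snd)
      (japp_prim.comp (Primrec.fst.comp (Primrec.fst.comp Primrec.fst)) Primrec.snd).to₂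
  have h2 : Primrec (fun p : List ℕ × ℕ =>
      (List.range p.1.length).map fun L => seg (japp p.1) L) :=
    Primrec.list_map (Primrec.list_range.comp h1) h3.to₂
  exact Primrec.list_headI.comp (runs_prim.comp
    (Primrec.pair h1 (Primrec.pair (Primrec.const c) (Primrec.pair h2 Primrec.snd))))

theorem seg_length (O : ℕ → ℕ) (s : ℕ) : (seg O s).length = s := by simp [seg]

theorem seg_take (O : ℕ → ℕ) {L s : ℕ} (h : L ≤ s) : (seg O s).take L = seg O L := by
  simp [seg, ← List.map_take, List.take_range, h]

theorem japp_lim (O : ℕ → ℕ) (e : ℕ) : ∃ N, ∀ s ≥ N, japp (seg O s) e = tjump O e := by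
  by_cases h : ((OCode.ofNat e).eval O e).Dom
  · obtain ⟨a, ha⟩ := Part.dom_iff_mem.1 h
    obtain ⟨L, hL⟩ := tr_complete O _ _ _ ha
    obtain ⟨k, hk⟩ := Code.evaln_complete.1 (hL L le_rfl)
    refine ⟨max (L + 1) k, fun s hs => ?_⟩
    have h1 : L < s := le_of_max_le_left hs
    have h2 : k ≤ s := le_of_max_le_right hs
    have hmem : a ∈ runs s (tr (OCode.ofNat e))
        ((List.range s).map fun L => (seg O s).take L) e := by
      refine List.mem_filterMap.2 ⟨seg O L, ?_, Code.evaln_mono h2 hk⟩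
      exact List.mem_map.2 ⟨L, List.mem_range.2 h1, seg_take O h1.le⟩
    rw [japp, tjump, if_pos h, seg_length, if_neg]
    intro h0
    rw [List.length_eq_zero_iff.1 h0] at hmem
    exact List.not_mem_nil hmem
  · refine ⟨0, fun s _ => ?_⟩
    rw [japp, tjump, if_neg h, seg_length, if_pos]
    rw [List.length_eq_zero_iff, List.eq_nil_iff_forall_not_mem]
    intro a ha
    obtain ⟨σ, hσ, hev⟩ := List.mem_filterMap.1 ha
    obtain ⟨L, hL, rfl⟩ := List.mem_map.1 hσ
    rw [seg_take O (List.mem_range.1 hL).le] at hev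
    exact h (Part.dom_iff_mem.2 ⟨a, tr_sound O L _ _ _ (Code.evaln_sound hev)⟩)

theorem japp_lim_seg (O : ℕ → ℕ) (M : ℕ) :
    ∃ N, ∀ s ≥ N, ∀ L ≤ M, seg (japp (seg O s)) L = seg (tjump O) L := by
  choose N hN using japp_lim O
  refine ⟨(Finset.range M).sup N, fun s hs L hL => ?_⟩
  refine List.map_congr_left fun e he => hN e s ?_
  exact le_trans (Finset.le_sup (Finset.mem_range.2
    (lt_of_lt_of_le (List.mem_range.1 he) hL))) hs

theorem uapp_lim {O f : ℕ → ℕ} {c : OCode} (hc : ∀ n, c.eval (tjump O) n = Part.some (f n))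
    (m : ℕ) : ∃ N, ∀ s ≥ N, uapp (tr c) (seg O s) m = f m := by
  obtain ⟨M, hM⟩ := tr_complete (tjump O) c m (f m) (by rw [hc]; exact Part.mem_some _)
  obtain ⟨k, hk⟩ := Code.evaln_complete.1 (hM M le_rfl)
  obtain ⟨N, hN⟩ := japp_lim_seg O M
  refine ⟨max N (max (M + 1) k), fun s hs => ?_⟩
  have h1 : N ≤ s := le_of_max_le_left hs
  have h2 : M + 1 ≤ s := le_of_max_le_left (le_of_max_le_right hs)
  have h3 : k ≤ s := le_of_max_le_right (le_of_max_le_right hs)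
  obtain ⟨r, rfl⟩ := Nat.exists_eq_add_of_le h2
  rw [uapp, seg_length]
  generalize hS : (M + 1 + r) = s at *
  have hr : List.range s = List.range (M + 1) ++ (List.range r).map (M + 1 + ·) := by
    rw [← hS, List.range_add]
  rw [hr, runs, List.map_append, List.filterMap_append]
  set l1 := List.filterMap (fun σ => Code.evaln s (tr c) (Nat.pair (Encodable.encode σ) m))
    ((List.range (M + 1)).map fun L => seg (japp (seg O s)) L) with hl1
  have hmem : f m ∈ l1 := by
    refine List.mem_filterMap.2 ⟨seg (tjump O) M, ?_, Code.evaln_mono h3 hk⟩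
    exact List.mem_map.2 ⟨M, List.mem_range.2 (Nat.lt_succ_self _), hN s h1 M le_rfl⟩
  have hall : ∀ a ∈ l1, a = f m := by
    intro a ha
    obtain ⟨σ, hσ, hev⟩ := List.mem_filterMap.1 ha
    obtain ⟨L, hL, rfl⟩ := List.mem_map.1 hσ
    rw [hN s h1 L (Nat.lt_succ_iff.1 (List.mem_range.1 hL))] at hev
    have := tr_sound _ _ _ _ _ (Code.evaln_sound hev)
    rw [hc] at this
    exact Part.mem_some_iff.1 this
  clear_value l1
  cases l1 with
  | nil => exact absurd hmem List.not_mem_nil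
  | cons a l => exact hall a List.mem_cons_self

theorem seg_le (O : ℕ → ℕ) : TuringLE (fun s => Encodable.encode (seg O s)) O := by
  have hF : Computable (fun z : ℕ => Encodable.encode
      ((Denumerable.ofNat (List ℕ) z.unpair.1) ++ [z.unpair.2])) :=
    (Primrec.encode.comp (Primrec.list_append.comp ((Primrec.ofNat (List ℕ)).comp pu1)
      (Primrec.list_cons.comp pu2 (Primrec.const [])))).to_comp
  have hg := le_comp (le_of_computable hF O) (le_pair
    (le_of_computable (pu2.comp pu2).to_comp O)
    (le_comp (le_refl' O) (le_of_computable (pu1.comp pu2).to_comp O)))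
  have hp := le_prec (le_of_computable (Computable.const (Encodable.encode ([] : List ℕ))) O) hg
  have := le_comp hp (le_of_computable
    (Primrec₂.natPair.comp (Primrec.const 0) Primrec.id).to_comp O)
  obtain ⟨c, hc⟩ := this
  refine ⟨c, fun s => ?_⟩
  rw [hc]
  congr 1
  simp only [Nat.unpair_pair, id]
  induction s with
  | zero => rfl
  | succ s ih =>
    simp only [ih, Denumerable.ofNat_encode]
    simp [seg, List.range_succ]

/-- Limit lemma, hard direction. -/
theorem exists_lim {f O : ℕ → ℕ} (hf : TuringLE f (tjump O)) :
    ∃ u : ℕ → ℕ, TuringLE u O ∧ ∀ m, EvLim (fun x => u (Nat.pair x m)) (f m) := by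
  obtain ⟨c, hc⟩ := hf
  refine ⟨fun z => uapp (tr c) (seg O z.unpair.1) z.unpair.2, ?_, fun m => ?_⟩
  · have hF : Computable (fun z : ℕ =>
        uapp (tr c) (Denumerable.ofNat (List ℕ) z.unpair.1) z.unpair.2) :=
      ((uapp_prim (tr c)).comp ((Primrec.ofNat (List ℕ)).comp pu1) pu2).to_comp
    have := le_comp (le_of_computable hF O) (le_pair
      (le_comp (seg_le O) (le_of_computable pu1.to_comp O)) (le_of_computable pu2.to_comp O))
    simpa using this
  · obtain ⟨N, hN⟩ := uapp_lim hc m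
    exact ⟨N, fun k hk => by simpa using hN k hk⟩

theorem prim_coord {a b : ℕ} {F : (Fin a → ℕ) → Fin b → ℕ}
    (h : ∀ i, Primrec fun v => F v i) : Primrec F :=
  Primrec.fin_curry.2 (Primrec₂.swap (Primrec.fin_curry₁.2 h))

theorem prim_app {a : ℕ} (i : Fin a) : Primrec (fun v : Fin a → ℕ => v i) :=
  Primrec.fin_app.comp Primrec.id (Primrec.const i)

theorem main (n : ℕ) : ∀ f : ℕ → ℕ, TuringLE f (zeroN n) ↔
    ∃ g : (Fin (n + 1) → ℕ) → ℕ, Computable g ∧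
      ∀ m : ℕ, IterLim n (fun xs => g (Fin.snoc xs m)) (f m) := by
  induction n with
  | zero =>
    intro f
    constructor
    · intro hf
      refine ⟨fun v => f (v (Fin.last 0)),
        (computable_of_le_zero hf).comp (prim_app _).to_comp, fun m => ?_⟩
      simp only [IterLim, Fin.snoc_last]
    · rintro ⟨g, hg, hm⟩
      refine le_of_computable ?_ _
      have : Primrec (fun m : ℕ => (fun _ => m : Fin 1 → ℕ)) :=
        Primrec.fin_curry.2 (Primrec.fst.to₂)
      refine (hg.comp this.to_comp).of_eq fun m => ?_
      rw [← (hm m : g (Fin.snoc _ m) = f m)]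
      congr 1
  | succ n ih =>
    intro f
    constructor
    · intro hf
      obtain ⟨u, hu, hlim⟩ := exists_lim (O := zeroN n) hf
      obtain ⟨g', hg', hg2⟩ := (ih u).1 hu
      refine ⟨fun v => g' (Fin.snoc (α := fun _ => ℕ) (fun i : Fin n => v i.succ.castSucc)
        (Nat.pair (v 0) (v (Fin.last _)))), ?_, fun m => ?_⟩
      · refine hg'.comp (Primrec.to_comp (prim_coord fun i => ?_))
        induction i using Fin.lastCases with
        | last =>
          simp only [Fin.snoc_last]
          exact Primrec₂.natPair.comp (prim_app _) (prim_app _)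
        | cast i =>
          simp only [Fin.snoc_castSucc]
          exact prim_app _
      · refine ⟨fun x => u (Nat.pair x m), fun x => ?_, hlim m⟩
        have := hg2 (Nat.pair x m)
        convert this using 4 with xs
        · funext i
          simp only [Fin.snoc_castSucc, Fin.cons_succ]
        · have : (0 : Fin (n + 1 + 1)) = Fin.castSucc (0 : Fin (n + 1)) := rfl
          rw [this, Fin.snoc_castSucc, Fin.cons_zero, Fin.snoc_last]
    · rintro ⟨g, hg, hm⟩
      choose U hU hlim using hm
      refine lim_le_jump (O := zeroN n) (u := fun z => U z.unpair.2 z.unpair.1) ?_ (fun m => ?_)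
      · refine (ih _).2 ⟨fun w => g (Fin.snoc (α := fun _ => ℕ)
          (Fin.cons (α := fun _ => ℕ) (w (Fin.last n)).unpair.1 (fun i : Fin n => w i.castSucc))
          (w (Fin.last n)).unpair.2), ?_, fun z => ?_⟩
        · refine hg.comp (Primrec.to_comp (prim_coord fun i => ?_))
          induction i using Fin.lastCases with
          | last =>
            simp only [Fin.snoc_last]
            exact pu2.comp (prim_app _)
          | cast i =>
            simp only [Fin.snoc_castSucc]
            induction i using Fin.cases with
            | zero => simp only [Fin.cons_zero]; exact pu1.comp (prim_app _)
            | succ i => simp only [Fin.cons_succ]; exact prim_app _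
        · have := hU z.unpair.2 z.unpair.1
          simp only [Fin.snoc_last, Fin.snoc_castSucc]
          exact this
      · simpa using hlim m

end LimLemma

/-- For `X ⊆ ℕ`: `X ≤_T 𝟎^(n)` iff there is a computable
`g : ℕ^{n+1} → ℕ` whose `n`-fold iterated limit (in the first `n` arguments)
`h` is total and `h ≡_T X`. -/
theorem stmt7 (n : ℕ) (X : Set ℕ) :
    TuringLE (charFun X) (zeroN n) ↔
      ∃ g : (Fin (n + 1) → ℕ) → ℕ, Computable g ∧
        ∃ h : ℕ → ℕ, (∀ m : ℕ, IterLim n (fun xs => g (Fin.snoc xs m)) (h m)) ∧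
          TuringEq h (charFun X) := by
  constructor
  · intro hX
    obtain ⟨g, hg, h⟩ := (LimLemma.main n _).1 hX
    exact ⟨g, hg, charFun X, h, LimLemma.le_refl' _, LimLemma.le_refl' _⟩
  · rintro ⟨g, hg, h, hl, -, hXh⟩
    exact LimLemma.le_trans' hXh ((LimLemma.main n h).2 ⟨g, hg, hl⟩)

end
end

section
/- Suppose X ⊆ ℕ satisfies X ≤_T 𝟎^(n) for some n ∈ ℕ. Then X is Turing equivalent to some function that is graph computable in constant time by a computable graph machine whose underlying colored graph is finitary (has a finite set of labels). -/
open scoped Classical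
noncomputable section

/-! ### Arithmetical predicates -/

theorem cp_comp {α β : Type} [Primcodable α] [Primcodable β] {P : β → Prop} {f : α → β}
    (h : ComputablePred P) (hf : Computable f) : ComputablePred (fun a => P (f a)) := by
  obtain ⟨g, hg, rfl⟩ := ComputablePred.computable_iff.1 h
  exact ComputablePred.computable_iff.2 ⟨fun a => g (f a), hg.comp hf, rfl⟩

theorem cp_not {α : Type} [Primcodable α] {P : α → Prop}
    (h : ComputablePred P) : ComputablePred (fun a => ¬ P a) := by
  obtain ⟨g, hg, rfl⟩ := ComputablePred.computable_iff.1 h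
  refine ComputablePred.computable_iff.2 ⟨fun a => !(g a), Primrec.not.to_comp.comp hg, ?_⟩
  funext a; simp

theorem cp_and {α : Type} [Primcodable α] {P Q : α → Prop}
    (h : ComputablePred P) (h' : ComputablePred Q) : ComputablePred (fun a => P a ∧ Q a) := by
  obtain ⟨g, hg, rfl⟩ := ComputablePred.computable_iff.1 h
  obtain ⟨g', hg', rfl⟩ := ComputablePred.computable_iff.1 h'
  refine ComputablePred.computable_iff.2 ⟨fun a => g a && g' a,
    Primrec.and.to_comp.comp hg hg', ?_⟩
  funext a; simp

theorem cp_or {α : Type} [Primcodable α] {P Q : α → Prop}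
    (h : ComputablePred P) (h' : ComputablePred Q) : ComputablePred (fun a => P a ∨ Q a) := by
  obtain ⟨g, hg, rfl⟩ := ComputablePred.computable_iff.1 h
  obtain ⟨g', hg', rfl⟩ := ComputablePred.computable_iff.1 h'
  refine ComputablePred.computable_iff.2 ⟨fun a => g a || g' a,
    Primrec.or.to_comp.comp hg hg', ?_⟩
  funext a; simp

theorem cp_of_prim {α : Type} [Primcodable α] {P : α → Prop}
    (h : PrimrecPred P) : ComputablePred P := by
  obtain ⟨i, h⟩ := h
  exact ⟨i, h.to_comp⟩

/-- Prenex (iterated no-witness) form of depth `k`. -/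
def ArithK : ℕ → (ℕ → Prop) → Prop
  | 0, P => ComputablePred P
  | k + 1, P => ∃ Q, ArithK k Q ∧ ∀ p, P p ↔ ¬ ∃ a, Q (Nat.pair p a)

theorem unpair1_comp : Computable (fun p : ℕ => p.unpair.1) :=
  (Primrec.fst.comp Primrec.unpair).to_comp
theorem unpair2_comp : Computable (fun p : ℕ => p.unpair.2) :=
  (Primrec.snd.comp Primrec.unpair).to_comp

theorem pair_comp {α : Type} [Primcodable α] {f g : α → ℕ} (hf : Computable f)
    (hg : Computable g) : Computable (fun a => Nat.pair (f a) (g a)) :=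
  Primrec₂.natPair.to_comp.comp hf hg

theorem ArithK.comp {k : ℕ} : ∀ {P : ℕ → Prop} {f : ℕ → ℕ}, ArithK k P → Computable f →
    ArithK k (fun p => P (f p)) := by
  induction k with
  | zero => intro P f h hf; exact cp_comp h hf
  | succ k ih =>
    rintro P f ⟨Q, hQ, h⟩ hf
    refine ⟨fun q => Q (Nat.pair (f q.unpair.1) q.unpair.2),
      ih hQ (pair_comp (hf.comp unpair1_comp) unpair2_comp), fun p => ?_⟩
    simp [h]

theorem ArithK.neg {k : ℕ} {P : ℕ → Prop} (h : ArithK k P) : ArithK (k + 1) (fun p => ¬ P p) :=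
  ⟨fun q => P q.unpair.1, h.comp unpair1_comp, fun p => by simp⟩

theorem ArithK.lift {k : ℕ} : ∀ {P : ℕ → Prop}, ArithK k P → ArithK (k + 1) P := by
  induction k with
  | zero =>
    intro P h
    exact ⟨fun q => ¬ P q.unpair.1, cp_not (cp_comp h unpair1_comp), fun p => by simp⟩
  | succ k ih =>
    rintro P ⟨Q, hQ, h⟩
    exact ⟨Q, ih hQ, h⟩

theorem ArithK.mono {k l : ℕ} (hkl : k ≤ l) {P : ℕ → Prop} (h : ArithK k P) : ArithK l P := by
  induction hkl with
  | refl => exact h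
  | step _ ih => exact ih.lift

theorem ArithK.and_or {k : ℕ} : ∀ {P Q : ℕ → Prop}, ArithK k P → ArithK k Q →
    ArithK k (fun p => P p ∧ Q p) ∧ ArithK k (fun p => P p ∨ Q p) := by
  induction k with
  | zero => intro P Q h h'; exact ⟨cp_and h h', cp_or h h'⟩
  | succ k ih =>
    rintro P P' ⟨Q, hQ, h⟩ ⟨Q', hQ', h'⟩
    constructor
    · refine ⟨fun q => Q q ∨ Q' q, (ih hQ hQ').2, fun p => ?_⟩
      show P p ∧ P' p ↔ ¬ ∃ a, Q (Nat.pair p a) ∨ Q' (Nat.pair p a)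
      rw [h, h']
      push Not
      exact forall_and.symm
    · refine ⟨fun q => Q (Nat.pair q.unpair.1 q.unpair.2.unpair.1) ∧
        Q' (Nat.pair q.unpair.1 q.unpair.2.unpair.2),
        (ih (hQ.comp (pair_comp unpair1_comp (unpair1_comp.comp unpair2_comp)))
          (hQ'.comp (pair_comp unpair1_comp (unpair2_comp.comp unpair2_comp)))).1, fun p => ?_⟩
      show P p ∨ P' p ↔ _
      rw [h, h']
      constructor
      · rintro (h | h) ⟨a, h1, h2⟩
        · exact h ⟨_, by simpa using h1⟩
        · exact h ⟨_, by simpa using h2⟩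
      · intro H
        by_contra hc
        push Not at hc
        obtain ⟨⟨a, ha⟩, ⟨b, hb⟩⟩ := hc
        exact H ⟨Nat.pair a b, by simpa using ⟨ha, hb⟩⟩

/-- Arithmetical predicates. -/
def Arith (P : ℕ → Prop) : Prop := ∃ k, ArithK k P

theorem Arith.of_comp {P : ℕ → Prop} (h : ComputablePred P) : Arith P := ⟨0, h⟩
theorem Arith.comp {P : ℕ → Prop} {f : ℕ → ℕ} (h : Arith P) (hf : Computable f) :
    Arith (fun p => P (f p)) := h.imp fun _ h => h.comp hf
theorem Arith.neg {P : ℕ → Prop} (h : Arith P) : Arith (fun p => ¬ P p) :=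
  let ⟨k, h⟩ := h; ⟨k + 1, h.neg⟩
theorem Arith.and {P Q : ℕ → Prop} (h : Arith P) (h' : Arith Q) :
    Arith (fun p => P p ∧ Q p) := by
  obtain ⟨k, h⟩ := h
  obtain ⟨l, h'⟩ := h'
  exact ⟨max k l, (ArithK.and_or (h.mono (le_max_left _ _)) (h'.mono (le_max_right _ _))).1⟩
theorem Arith.or {P Q : ℕ → Prop} (h : Arith P) (h' : Arith Q) :
    Arith (fun p => P p ∨ Q p) := by
  obtain ⟨k, h⟩ := h
  obtain ⟨l, h'⟩ := h'
  exact ⟨max k l, (ArithK.and_or (h.mono (le_max_left _ _)) (h'.mono (le_max_right _ _))).2⟩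
theorem Arith.all {P : ℕ → ℕ → Prop} (h : Arith (fun q => P q.unpair.1 q.unpair.2)) :
    Arith (fun p => ∀ a, P p a) := by
  obtain ⟨k, h⟩ := h.neg
  exact ⟨k + 1, _, h, fun p => by simp⟩
theorem Arith.ex {P : ℕ → ℕ → Prop} (h : Arith (fun q => P q.unpair.1 q.unpair.2)) :
    Arith (fun p => ∃ a, P p a) := by
  have := (Arith.all (P := fun p a => ¬ P p a) h.neg).neg
  simpa using this
theorem Arith.of_iff {P Q : ℕ → Prop} (h : Arith P) (H : ∀ p, Q p ↔ P p) : Arith Q := by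
  have : Q = P := funext fun p => propext (H p)
  rwa [this]

/-- Unfolding the prenex form to a sequence of predicates. -/
theorem ArithK.family {k : ℕ} : ∀ {P : ℕ → Prop}, ArithK k P →
    ∃ F : ℕ → ℕ → Prop, F 0 = P ∧ ComputablePred (F k) ∧
      ∀ j < k, ∀ p, F j p ↔ ¬ ∃ a, F (j + 1) (Nat.pair p a) := by
  induction k with
  | zero => intro P h; exact ⟨fun _ => P, rfl, h, by simp⟩
  | succ k ih =>
    rintro P ⟨Q, hQ, h⟩
    obtain ⟨F, h0, hk, hF⟩ := ih hQ
    refine ⟨fun j => Nat.casesOn j P F, rfl, hk, fun j hj p => ?_⟩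
    cases j with
    | zero => simpa [h0] using h p
    | succ j => exact hF j (by omega) p

/-! ### Big-step semantics of oracle codes -/

/-- Evaluation with a partial oracle. -/
def OCode.evalP (O : ℕ → Part ℕ) : OCode → ℕ → Part ℕ
  | .zero => fun _ => Part.some 0
  | .succ => fun n => Part.some (n + 1)
  | .left => fun n => Part.some (Nat.unpair n).1
  | .right => fun n => Part.some (Nat.unpair n).2
  | .oracle => fun n => O n
  | .pair cf cg => fun n => Nat.pair <$> OCode.evalP O cf n <*> OCode.evalP O cg n
  | .comp cf cg => fun n => OCode.evalP O cg n >>= OCode.evalP O cf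
  | .prec cf cg =>
      Nat.unpaired fun a n =>
        n.rec (OCode.evalP O cf a) fun y IH => do
          let i ← IH
          OCode.evalP O cg (Nat.pair a (Nat.pair y i))
  | .rfind' cf =>
      Nat.unpaired fun a m =>
        (Nat.rfind fun n => (fun x => x = 0) <$> OCode.evalP O cf (Nat.pair a (n + m))).map (· + m)

theorem OCode.eval_eq_evalP (O : ℕ → ℕ) (c : OCode) :
    c.eval O = c.evalP (fun n => Part.some (O n)) := by
  induction c with
  | zero => rfl
  | succ => rfl
  | left => rfl
  | right => rfl
  | oracle => rfl
  | pair a b iha ihb => simp only [OCode.eval, OCode.evalP, iha, ihb]; rfl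
  | comp a b iha ihb => simp only [OCode.eval, OCode.evalP, iha, ihb]; rfl
  | prec a b iha ihb => simp only [OCode.eval, OCode.evalP, iha, ihb]; rfl
  | rfind' a iha => simp only [OCode.eval, OCode.evalP, iha]; rfl

/-- Substituting a code for the oracle. -/
def OCode.sub (d : Nat.Partrec.Code) : OCode → Nat.Partrec.Code
  | .zero => .zero
  | .succ => .succ
  | .left => .left
  | .right => .right
  | .oracle => d
  | .pair a b => .pair (a.sub d) (b.sub d)
  | .comp a b => .comp (a.sub d) (b.sub d)
  | .prec a b => .prec (a.sub d) (b.sub d)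
  | .rfind' a => .rfind' (a.sub d)

theorem OCode.sub_eval (d : Nat.Partrec.Code) (c : OCode) :
    (c.sub d).eval = c.evalP d.eval := by
  induction c with
  | zero => rfl
  | succ => rfl
  | left => rfl
  | right => rfl
  | oracle => rfl
  | pair a b iha ihb => simp only [OCode.sub, OCode.evalP, Nat.Partrec.Code.eval, iha, ihb]; rfl
  | comp a b iha ihb => simp only [OCode.sub, OCode.evalP, Nat.Partrec.Code.eval, iha, ihb]; rfl
  | prec a b iha ihb => simp only [OCode.sub, OCode.evalP, Nat.Partrec.Code.eval, iha, ihb]; rfl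
  | rfind' a iha => simp only [OCode.sub, OCode.evalP, Nat.Partrec.Code.eval, iha]; rfl

/-- Big-step semantics. -/
inductive OEv (R : ℕ → ℕ → Prop) : OCode → ℕ → ℕ → Prop
  | zero (n) : OEv R .zero n 0
  | succ (n) : OEv R .succ n (n + 1)
  | left (n) : OEv R .left n n.unpair.1
  | right (n) : OEv R .right n n.unpair.2
  | oracle (n y) (h : R n y) : OEv R .oracle n y
  | pair (a b n y z) (h : OEv R a n y) (h' : OEv R b n z) : OEv R (.pair a b) n (Nat.pair y z)
  | comp (a b n y z) (h : OEv R b n y) (h' : OEv R a y z) : OEv R (.comp a b) n z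
  | prec0 (a b n y) (h : OEv R a n y) : OEv R (.prec a b) (Nat.pair n 0) y
  | precS (a b n k i y) (h : OEv R (.prec a b) (Nat.pair n k) i)
      (h' : OEv R b (Nat.pair n (Nat.pair k i)) y) : OEv R (.prec a b) (Nat.pair n (k + 1)) y
  | rfind0 (a n m) (h : OEv R a (Nat.pair n m) 0) : OEv R (.rfind' a) (Nat.pair n m) m
  | rfindS (a n m z y) (h : OEv R a (Nat.pair n m) (z + 1))
      (h' : OEv R (.rfind' a) (Nat.pair n (m + 1)) y) : OEv R (.rfind' a) (Nat.pair n m) y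

theorem OEv.mono {R R' : ℕ → ℕ → Prop} {c n y} (h : OEv R c n y)
    (H : ∀ n y, R n y → R' n y) : OEv R' c n y := by
  induction h with
  | oracle n y h => exact .oracle _ _ (H _ _ h)
  | zero => exact .zero _
  | succ => exact .succ _
  | left => exact .left _
  | right => exact .right _
  | pair a b n y z _ _ ih ih' => exact .pair _ _ _ _ _ ih ih'
  | comp a b n y z _ _ ih ih' => exact .comp _ _ _ _ _ ih ih'
  | prec0 a b n y _ ih => exact .prec0 _ _ _ _ ih
  | precS a b n k i y _ _ ih ih' => exact .precS _ _ _ _ _ _ ih ih'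
  | rfind0 a n m _ ih => exact .rfind0 _ _ _ ih
  | rfindS a n m z y _ _ ih ih' => exact .rfindS _ _ _ _ _ ih ih'

theorem OEv.compact {R : ℕ → ℕ → Prop} {c n y} (h : OEv R c n y) :
    ∃ N, ∀ N' ≥ N, OEv (fun n y => n < N' ∧ R n y) c n y := by
  induction h with
  | oracle n y h => exact ⟨n + 1, fun N' hN => .oracle _ _ ⟨hN, h⟩⟩
  | zero => exact ⟨0, fun _ _ => .zero _⟩
  | succ => exact ⟨0, fun _ _ => .succ _⟩
  | left => exact ⟨0, fun _ _ => .left _⟩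
  | right => exact ⟨0, fun _ _ => .right _⟩
  | pair a b n y z _ _ ih ih' =>
    obtain ⟨N, ih⟩ := ih
    obtain ⟨N', ih'⟩ := ih'
    exact ⟨max N N', fun K hK => .pair _ _ _ _ _ (ih K (le_of_max_le_left hK))
      (ih' K (le_of_max_le_right hK))⟩
  | comp a b n y z _ _ ih ih' =>
    obtain ⟨N, ih⟩ := ih
    obtain ⟨N', ih'⟩ := ih'
    exact ⟨max N N', fun K hK => .comp _ _ _ _ _ (ih K (le_of_max_le_left hK))
      (ih' K (le_of_max_le_right hK))⟩
  | prec0 a b n y _ ih =>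
    obtain ⟨N, ih⟩ := ih
    exact ⟨N, fun K hK => .prec0 _ _ _ _ (ih K hK)⟩
  | precS a b n k i y _ _ ih ih' =>
    obtain ⟨N, ih⟩ := ih
    obtain ⟨N', ih'⟩ := ih'
    exact ⟨max N N', fun K hK => .precS _ _ _ _ _ _ (ih K (le_of_max_le_left hK))
      (ih' K (le_of_max_le_right hK))⟩
  | rfind0 a n m _ ih =>
    obtain ⟨N, ih⟩ := ih
    exact ⟨N, fun K hK => .rfind0 _ _ _ (ih K hK)⟩
  | rfindS a n m z y _ _ ih ih' =>
    obtain ⟨N, ih⟩ := ih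
    obtain ⟨N', ih'⟩ := ih'
    exact ⟨max N N', fun K hK => .rfindS _ _ _ _ _ (ih K (le_of_max_le_left hK))
      (ih' K (le_of_max_le_right hK))⟩

theorem OEv.complete (O : ℕ → Part ℕ) (c : OCode) :
    ∀ n y, y ∈ c.evalP O n → OEv (fun n y => y ∈ O n) c n y := by
  induction c with
  | zero => intro n y h; simp [OCode.evalP] at h; subst h; exact .zero _
  | succ => intro n y h; simp [OCode.evalP] at h; subst h; exact .succ _
  | left => intro n y h; simp [OCode.evalP] at h; subst h; exact .left _
  | right => intro n y h; simp [OCode.evalP] at h; subst h; exact .right _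
  | oracle => intro n y h; exact .oracle _ _ h
  | pair a b iha ihb =>
    intro n y h
    simp [OCode.evalP, Seq.seq] at h
    obtain ⟨u, hu, v, hv, rfl⟩ := h
    exact .pair _ _ _ _ _ (iha _ _ hu) (ihb _ _ hv)
  | comp a b iha ihb =>
    intro n y h
    simp [OCode.evalP] at h
    obtain ⟨u, hu, hv⟩ := h
    exact .comp _ _ _ _ _ (ihb _ _ hu) (iha _ _ hv)
  | prec a b iha ihb =>
    intro n y h
    rw [← Nat.pair_unpair n] at h ⊢
    generalize n.unpair.1 = u at *
    generalize n.unpair.2 = k at *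
    simp [OCode.evalP] at h
    induction k generalizing y with
    | zero => exact .prec0 _ _ _ _ (iha _ _ h)
    | succ k ih =>
      simp at h
      obtain ⟨i, hi, h⟩ := h
      exact .precS _ _ _ _ _ _ (ih _ hi) (ihb _ _ h)
  | rfind' a iha =>
    intro n y h
    rw [← Nat.pair_unpair n] at h ⊢
    generalize n.unpair.1 = u at *
    generalize n.unpair.2 = m at *
    simp only [OCode.evalP, Nat.unpaired, Nat.unpair_pair, Part.mem_map_iff] at h
    obtain ⟨t, ht, rfl⟩ := h
    obtain ⟨h1, h2⟩ := Nat.mem_rfind.1 ht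
    have h1' : 0 ∈ a.evalP O (Nat.pair u (t + m)) := by simpa using h1
    have h2' : ∀ j < t, ∃ z, z + 1 ∈ a.evalP O (Nat.pair u (j + m)) := by
      intro j hj
      have := h2 hj
      simp at this
      obtain ⟨z, hz, hz0⟩ := this
      obtain ⟨z, rfl⟩ := Nat.exists_eq_succ_of_ne_zero hz0
      exact ⟨z, hz⟩
    clear h1 h2 ht
    induction t generalizing m with
    | zero => simp at h1' ⊢; exact .rfind0 _ _ _ (iha _ _ h1')
    | succ t ih =>
      obtain ⟨z, hz⟩ := h2' 0 (by omega)
      rw [Nat.zero_add] at hz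
      have := ih (m + 1) (by rwa [show t + (m + 1) = t + 1 + m by omega]) (fun j hj => by
        obtain ⟨z, hz⟩ := h2' (j + 1) (by omega)
        exact ⟨z, by rwa [show j + (m + 1) = j + 1 + m by omega]⟩)
      refine .rfindS _ _ _ _ _ (iha _ _ hz) ?_
      convert this using 1
      omega

theorem OEv.sound (O : ℕ → Part ℕ) {c : OCode} {n y} (h : OEv (fun n y => y ∈ O n) c n y) :
    y ∈ c.evalP O n := by
  induction h with
  | oracle n y h => exact h
  | zero => simp [OCode.evalP]
  | succ => simp [OCode.evalP]
  | left => simp [OCode.evalP]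
  | right => simp [OCode.evalP]
  | pair a b n y z _ _ ih ih' => simpa [OCode.evalP, Seq.seq] using ⟨ih, ih'⟩
  | comp a b n y z _ _ ih ih' => simp [OCode.evalP]; exact ⟨_, ih, ih'⟩
  | prec0 a b n y _ ih => simpa [OCode.evalP] using ih
  | precS a b n k i y _ _ ih ih' =>
    simp [OCode.evalP] at ih ⊢
    exact ⟨_, ih, ih'⟩
  | rfind0 a n m _ ih =>
    simp only [OCode.evalP, Nat.unpaired, Nat.unpair_pair, Part.mem_map_iff]
    refine ⟨0, ?_, by simp⟩
    refine Nat.mem_rfind.2 ?_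
    simpa using ih
  | rfindS a n m z y _ _ ih ih' =>
    simp only [OCode.evalP, Nat.unpaired, Nat.unpair_pair, Part.mem_map_iff] at ih' ⊢
    obtain ⟨t, ht, rfl⟩ := ih'
    refine ⟨t + 1, ?_, by omega⟩
    obtain ⟨h1, h2⟩ := Nat.mem_rfind.1 ht
    refine Nat.mem_rfind.2 ?_
    constructor
    · convert h1 using 4; omega
    · intro j hj
      cases j with
      | zero => simp; exact ⟨_, ih, by simp⟩
      | succ j =>
        have := h2 (show j < t by omega)
        convert this using 4; omega

/-! ### Uniform substitution and the arithmetical hierarchy -/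

open Nat.Partrec (Code)

/-- Course-of-values step for `OCode.sub d (OCode.ofNat n)`. -/
def subStep (d : Code) (l : List Code) : Option Code :=
  if l.length = 0 then some Code.zero
  else if l.length = 1 then some Code.succ
  else if l.length = 2 then some Code.left
  else if l.length = 3 then some Code.right
  else if l.length = 4 then some d
  else
    (l[((l.length - 5) / 4).unpair.1]?).bind fun a =>
      (l[((l.length - 5) / 4).unpair.2]?).bind fun b =>
        some (if (l.length - 5) % 4 = 0 then Code.pair a b
          else if (l.length - 5) % 4 = 1 then Code.comp a b
          else if (l.length - 5) % 4 = 2 then Code.prec a b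
          else Code.rfind' a)

theorem len_eq_pr {α β : Type} [Primcodable α] [Primcodable β] {f : α → List β} (hf : Primrec f)
    (k : ℕ) : PrimrecPred (fun a => (f a).length = k) :=
  Primrec.eq.comp (Primrec.list_length.comp hf) (Primrec.const k)

theorem subStep_prim : Primrec₂ subStep := by
  have hl : Primrec (fun p : Code × List Code => p.2) := Primrec.snd
  have hm : Primrec (fun p : Code × List Code => p.2.length - 5) :=
    Primrec.nat_sub.comp (Primrec.list_length.comp hl) (Primrec.const 5)
  have hq : Primrec (fun p : Code × List Code => ((p.2.length - 5) / 4).unpair) :=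
    Primrec.unpair.comp (Primrec.nat_div.comp hm (Primrec.const 4))
  have hr : Primrec (fun p : Code × List Code => (p.2.length - 5) % 4) :=
    Primrec.nat_mod.comp hm (Primrec.const 4)
  unfold Primrec₂ subStep
  refine Primrec.ite (len_eq_pr hl 0) (Primrec.const _) ?_
  refine Primrec.ite (len_eq_pr hl 1) (Primrec.const _) ?_
  refine Primrec.ite (len_eq_pr hl 2) (Primrec.const _) ?_
  refine Primrec.ite (len_eq_pr hl 3) (Primrec.const _) ?_
  refine Primrec.ite (len_eq_pr hl 4) (Primrec.option_some.comp Primrec.fst) ?_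
  refine Primrec.option_bind (Primrec.list_getElem?.comp hl (Primrec.fst.comp hq)) ?_
  refine Primrec.option_bind (f := fun q : (Code × List Code) × Code =>
    q.1.2[((q.1.2.length - 5) / 4).unpair.2]?)
    (Primrec.list_getElem?.comp (hl.comp Primrec.fst)
    (Primrec.snd.comp (hq.comp Primrec.fst))) ?_
  refine Primrec.option_some.comp ?_
  have ha : Primrec (fun q : ((Code × List Code) × Code) × Code => q.1.2) :=
    Primrec.snd.comp Primrec.fst
  have hb : Primrec (fun q : ((Code × List Code) × Code) × Code => q.2) := Primrec.snd
  have hr' : Primrec (fun q : ((Code × List Code) × Code) × Code =>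
    (q.1.1.2.length - 5) % 4) := hr.comp (Primrec.fst.comp Primrec.fst)
  refine Primrec.ite (Primrec.eq.comp hr' (Primrec.const 0)) (Code.primrec₂_pair.comp ha hb) ?_
  refine Primrec.ite (Primrec.eq.comp hr' (Primrec.const 1)) (Code.primrec₂_comp.comp ha hb) ?_
  refine Primrec.ite (Primrec.eq.comp hr' (Primrec.const 2)) (Code.primrec₂_prec.comp ha hb) ?_
  exact Code.primrec_rfind'.comp ha

theorem ofNat_add_five (n : ℕ) : OCode.ofNat (n + 5) =
    if n % 4 = 0 then .pair (OCode.ofNat (n / 4).unpair.1) (OCode.ofNat (n / 4).unpair.2)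
    else if n % 4 = 1 then .comp (OCode.ofNat (n / 4).unpair.1) (OCode.ofNat (n / 4).unpair.2)
    else if n % 4 = 2 then .prec (OCode.ofNat (n / 4).unpair.1) (OCode.ofNat (n / 4).unpair.2)
    else .rfind' (OCode.ofNat (n / 4).unpair.1) := by
  rw [OCode.ofNat]
  have : n % 4 < 4 := Nat.mod_lt _ (by norm_num)
  generalize n % 4 = r at *
  interval_cases r <;> simp

theorem ofNat_surj (c : OCode) : ∃ e, OCode.ofNat e = c := by
  induction c with
  | zero => exact ⟨0, by simp [OCode.ofNat]⟩
  | succ => exact ⟨1, by simp [OCode.ofNat]⟩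
  | left => exact ⟨2, by simp [OCode.ofNat]⟩
  | right => exact ⟨3, by simp [OCode.ofNat]⟩
  | oracle => exact ⟨4, by simp [OCode.ofNat]⟩
  | pair a b iha ihb =>
    obtain ⟨x, rfl⟩ := iha
    obtain ⟨y, rfl⟩ := ihb
    refine ⟨4 * Nat.pair x y + 5, ?_⟩
    rw [ofNat_add_five]
    simp
  | comp a b iha ihb =>
    obtain ⟨x, rfl⟩ := iha
    obtain ⟨y, rfl⟩ := ihb
    refine ⟨4 * Nat.pair x y + 1 + 5, ?_⟩
    rw [ofNat_add_five, show (4 * Nat.pair x y + 1) % 4 = 1 by omega,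
      show (4 * Nat.pair x y + 1) / 4 = Nat.pair x y by omega]
    simp
  | prec a b iha ihb =>
    obtain ⟨x, rfl⟩ := iha
    obtain ⟨y, rfl⟩ := ihb
    refine ⟨4 * Nat.pair x y + 2 + 5, ?_⟩
    rw [ofNat_add_five, show (4 * Nat.pair x y + 2) % 4 = 2 by omega,
      show (4 * Nat.pair x y + 2) / 4 = Nat.pair x y by omega]
    simp
  | rfind' a iha =>
    obtain ⟨x, rfl⟩ := iha
    refine ⟨4 * Nat.pair x 0 + 3 + 5, ?_⟩
    rw [ofNat_add_five, show (4 * Nat.pair x 0 + 3) % 4 = 3 by omega,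
      show (4 * Nat.pair x 0 + 3) / 4 = Nat.pair x 0 by omega]
    simp

theorem sub_prim : Primrec₂ (fun (d : Code) (e : ℕ) => (OCode.ofNat e).sub d) := by
  refine Primrec.nat_strong_rec _ subStep_prim ?_
  intro d n
  match n with
  | 0 => simp [subStep, OCode.ofNat, OCode.sub]
  | 1 => simp [subStep, OCode.ofNat, OCode.sub]
  | 2 => simp [subStep, OCode.ofNat, OCode.sub]
  | 3 => simp [subStep, OCode.ofNat, OCode.sub]
  | 4 => simp [subStep, OCode.ofNat, OCode.sub]
  | n + 5 =>
    have h1 : (n / 4).unpair.1 < n + 5 :=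
      Nat.lt_succ_of_le (le_trans (Nat.unpair_left_le _)
        (le_trans (Nat.div_le_self n 4) (Nat.le_add_right n 4)))
    have h2 : (n / 4).unpair.2 < n + 5 :=
      Nat.lt_succ_of_le (le_trans (Nat.unpair_right_le _)
        (le_trans (Nat.div_le_self n 4) (Nat.le_add_right n 4)))
    have e1 : ((List.range (n + 5)).map fun e => (OCode.ofNat e).sub d)[(n / 4).unpair.1]? =
        some ((OCode.ofNat (n / 4).unpair.1).sub d) := by
      simp [h1]
    have e2 : ((List.range (n + 5)).map fun e => (OCode.ofNat e).sub d)[(n / 4).unpair.2]? =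
        some ((OCode.ofNat (n / 4).unpair.2).sub d) := by
      simp [h2]
    rw [ofNat_add_five]
    have h0 : n + 5 ≠ 0 := by omega
    have h1 : n + 5 ≠ 1 := by omega
    have h2 : n + 5 ≠ 2 := by omega
    have h3 : n + 5 ≠ 3 := by omega
    have h4 : n + 5 ≠ 4 := by omega
    have h5 : n + 5 - 5 = n := by omega
    unfold subStep
    simp only [List.length_map, List.length_range, h0, h1, h2, h3, h4, h5, if_false, e1, e2,
      Option.bind_some]
    split_ifs <;> rfl

/-- Lookup in a coded list. -/
def lk (s i : ℕ) : Option ℕ := (Denumerable.ofNat (List ℕ) s)[i]?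

theorem lk_prim : Primrec₂ lk :=
  Primrec.list_getElem?.comp ((Primrec.ofNat _).comp Primrec.fst) Primrec.snd

theorem exists_lookup : ∃ c : Code, ∀ s i, (c.curry s).eval i = ↑(lk s i) := by
  have : Nat.Partrec (fun p : ℕ => ((lk p.unpair.1 p.unpair.2 : Option ℕ) : Part ℕ)) := by
    have h : Computable (fun p : ℕ => lk p.unpair.1 p.unpair.2) :=
      lk_prim.to_comp.comp unpair1_comp unpair2_comp
    exact Partrec.nat_iff.1 h.ofOption
  obtain ⟨c, hc⟩ := Code.exists_code.1 this
  refine ⟨c, fun s i => ?_⟩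
  rw [Code.eval_curry, hc]
  simp

theorem eval_iff (O : ℕ → ℕ) {lc : Code} (hlc : ∀ s i, (lc.curry s).eval i = ↑(lk s i))
    (c : OCode) (n y : ℕ) :
    y ∈ c.eval O n ↔ ∃ s, (∀ q : ℕ, q.unpair.2 ∈ lk s q.unpair.1 → O q.unpair.1 = q.unpair.2) ∧
      y ∈ (c.sub (lc.curry s)).eval n := by
  constructor
  · intro h
    rw [OCode.eval_eq_evalP] at h
    obtain ⟨N, hN⟩ := (OEv.complete _ _ _ _ h).compact
    have hN := hN N le_rfl
    have hlk : ∀ i v, v ∈ lk (Encodable.encode ((List.range N).map O)) i ↔ i < N ∧ v = O i := by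
      intro i v
      simp only [lk, Denumerable.ofNat_encode, Option.mem_def, List.getElem?_map]
      by_cases hi : i < N
      · simp [hi, eq_comm]
      · simp [hi]
    refine ⟨Encodable.encode ((List.range N).map O), ?_, ?_⟩
    · intro q hq
      exact ((hlk _ _).1 hq).2.symm
    · rw [OCode.sub_eval]
      apply OEv.sound
      refine hN.mono ?_
      rintro i v ⟨hi, hv⟩
      rw [hlc, Part.mem_coe, hlk]
      exact ⟨hi, by simpa using hv⟩
  · rintro ⟨s, hs, h⟩
    rw [OCode.sub_eval] at h
    rw [OCode.eval_eq_evalP]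
    apply OEv.sound
    refine (OEv.complete _ _ _ _ h).mono ?_
    intro i v hv
    rw [hlc, Part.mem_coe] at hv
    have := hs (Nat.pair i v) (by simpa using hv)
    simpa using this.symm

/-- The graph of a function is arithmetical. -/
def ArithFn (O : ℕ → ℕ) : Prop := Arith (fun q => O q.unpair.1 = q.unpair.2)

theorem arith_eval {O : ℕ → ℕ} (hO : ArithFn O) :
    Arith (fun q => q.unpair.2 ∈
      (OCode.ofNat q.unpair.1.unpair.1).eval O q.unpair.1.unpair.2) := by
  obtain ⟨lc, hlc⟩ := exists_lookup
  have hcon : Arith (fun s => ∀ q : ℕ, q.unpair.2 ∈ lk s q.unpair.1 →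
      O q.unpair.1 = q.unpair.2) := by
    have h1 : ComputablePred (fun r : ℕ =>
        r.unpair.2.unpair.2 ∈ lk r.unpair.1 r.unpair.2.unpair.1) := by
      have : Computable (fun r : ℕ => lk r.unpair.1 r.unpair.2.unpair.1) :=
        lk_prim.to_comp.comp unpair1_comp (unpair1_comp.comp unpair2_comp)
      exact cp_comp (P := fun p : Option ℕ × Option ℕ => p.1 = p.2) (cp_of_prim Primrec.eq)
        (this.pair (Computable.option_some.comp (unpair2_comp.comp unpair2_comp)))
    refine Arith.all (P := fun s q => q.unpair.2 ∈ lk s q.unpair.1 →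
      O q.unpair.1 = q.unpair.2) ?_
    refine Arith.of_iff ((Arith.of_comp (cp_not h1)).or (hO.comp unpair2_comp)) ?_
    intro p
    exact imp_iff_not_or
  have hev : ComputablePred (fun r : ℕ => r.unpair.1.unpair.2 ∈
      Code.evaln r.unpair.2.unpair.2 ((OCode.ofNat r.unpair.1.unpair.1.unpair.1).sub
        (lc.curry r.unpair.2.unpair.1)) r.unpair.1.unpair.1.unpair.2) := by
    have u11 := unpair1_comp.comp unpair1_comp
    have hsub : Computable (fun r : ℕ => (OCode.ofNat r.unpair.1.unpair.1.unpair.1).sub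
        (lc.curry r.unpair.2.unpair.1)) :=
      sub_prim.to_comp.comp (Code.primrec₂_curry.to_comp.comp (Computable.const lc)
        (unpair1_comp.comp unpair2_comp)) (unpair1_comp.comp u11)
    have := Code.primrec_evaln.to_comp.comp
      (((unpair2_comp.comp unpair2_comp).pair hsub).pair (unpair2_comp.comp u11))
    exact cp_comp (P := fun p : Option ℕ × Option ℕ => p.1 = p.2) (cp_of_prim Primrec.eq)
        (this.pair (Computable.option_some.comp (unpair2_comp.comp unpair1_comp)))
  have key := Arith.ex (P := fun q r => (∀ t : ℕ, t.unpair.2 ∈ lk r.unpair.1 t.unpair.1 →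
      O t.unpair.1 = t.unpair.2) ∧ q.unpair.2 ∈
      Code.evaln r.unpair.2 ((OCode.ofNat q.unpair.1.unpair.1).sub
        (lc.curry r.unpair.1)) q.unpair.1.unpair.2)
    ((hcon.comp (unpair1_comp.comp unpair2_comp)).and (Arith.of_comp hev))
  refine key.of_iff fun q => ?_
  rw [eval_iff O hlc]
  constructor
  · rintro ⟨s, hs, h⟩
    obtain ⟨k, hk⟩ := Code.evaln_complete.1 h
    exact ⟨Nat.pair s k, by simpa using hs, by simpa using hk⟩
  · rintro ⟨r, hs, h⟩
    exact ⟨r.unpair.1, hs, Code.evaln_complete.2 ⟨_, h⟩⟩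

theorem ArithFn.jump {O : ℕ → ℕ} (hO : ArithFn O) : ArithFn (tjump O) := by
  have hD : Arith (fun e => ((OCode.ofNat e).eval O e).Dom) := by
    refine Arith.of_iff (Arith.ex (P := fun e y => y ∈ (OCode.ofNat e).eval O e) ?_)
      fun e => Part.dom_iff_mem
    refine Arith.of_iff ((arith_eval hO).comp
      (pair_comp (pair_comp unpair1_comp unpair1_comp) unpair2_comp)) fun q => ?_
    simp
  have hc : ∀ k : ℕ, Arith (fun q => q.unpair.2 = k) := fun k =>
    Arith.of_comp (cp_comp (P := fun x : ℕ => x = k)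
      (cp_of_prim (Primrec.eq.comp Primrec.id (Primrec.const k))) unpair2_comp)
  have hD' := hD.comp unpair1_comp
  refine ((hD'.and (hc 1)).or (hD'.neg.and (hc 0))).of_iff fun q => ?_
  unfold tjump
  split_ifs with h <;> simp [h, eq_comm]

theorem arithFn_zeroN (n : ℕ) : ArithFn (zeroN n) := by
  unfold zeroN
  induction n with
  | zero =>
    exact Arith.of_comp (cp_comp (P := fun x : ℕ => 0 = x)
      (cp_of_prim (Primrec.eq.comp (Primrec.const 0) Primrec.id)) unpair2_comp)
  | succ n ih => exact ih.jump

theorem arith_of_le {X : Set ℕ} {O : ℕ → ℕ} (hO : ArithFn O) (h : TuringLE (charFun X) O) :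
    Arith (· ∈ X) := by
  obtain ⟨c, hc⟩ := h
  obtain ⟨e, rfl⟩ := ofNat_surj c
  refine Arith.of_iff ((arith_eval hO).comp (f := fun m => Nat.pair (Nat.pair e m) 1)
    (pair_comp (pair_comp (Computable.const e) Computable.id) (Computable.const 1))) fun m => ?_
  simp [hc, charFun]

/-! ### Computable functions and oracle codes -/

/-- Ordinary codes as oracle codes. -/
def ofCode : Code → OCode
  | .zero => .zero
  | .succ => .succ
  | .left => .left
  | .right => .right
  | .pair a b => .pair (ofCode a) (ofCode b)
  | .comp a b => .comp (ofCode a) (ofCode b)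
  | .prec a b => .prec (ofCode a) (ofCode b)
  | .rfind' a => .rfind' (ofCode a)

theorem ofCode_sub (d c : Code) : (ofCode c).sub d = c := by
  induction c <;> simp_all [ofCode, OCode.sub]

theorem ofCode_evalP (O O' : ℕ → Part ℕ) (c : Code) :
    (ofCode c).evalP O = (ofCode c).evalP O' := by
  induction c <;> simp_all [ofCode, OCode.evalP]

theorem ofCode_eval (O : ℕ → ℕ) (c : Code) : (ofCode c).eval O = c.eval := by
  rw [OCode.eval_eq_evalP, ofCode_evalP _ (Code.eval .zero), ← OCode.sub_eval, ofCode_sub]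

theorem exists_ocode {f : ℕ → ℕ} (hf : Computable f) :
    ∃ c : OCode, ∀ O n, c.eval O n = Part.some (f n) := by
  obtain ⟨c, hc⟩ := Code.exists_code.1 (Partrec.nat_iff.1 hf)
  refine ⟨ofCode c, fun O n => ?_⟩
  rw [ofCode_eval, hc]
  rfl

theorem turingLE_of {f g : ℕ → ℕ} {h : ℕ → ℕ} {F : ℕ → ℕ → ℕ} (hh : Computable h)
    (hF : Computable₂ F) (H : ∀ n, f n = F n (g (h n))) : TuringLE f g := by
  obtain ⟨ch, hch⟩ := exists_ocode hh
  obtain ⟨ci, hci⟩ := exists_ocode Computable.id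
  obtain ⟨cF, hcF⟩ := exists_ocode (f := fun p => F p.unpair.1 p.unpair.2)
    (hF.comp unpair1_comp unpair2_comp)
  refine ⟨.comp cF (.pair ci (.comp .oracle ch)), fun n => ?_⟩
  simp [OCode.eval, hch, hci, H, Seq.seq]
  exact (Part.bind_some _ _).trans (by simp [hcF])

/-! ### The machine -/

/-- Nontrivial part of the transition table. -/
def Tm (k l : ℕ) (b0 b1 : Prop) (z t : ℕ) : Finset ℕ × ℕ × ℕ :=
  if t = 0 ∧ ¬ b1 then (if z = 0 then (∅, 0, 0) else ({1}, 0, 0))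
  else ((if t + l = k ∧ ¬ b0 then {0} else ∅),
    (if (t + l = k ∧ ¬ b0) ∧ l = 0 then 1 else if t = 0 then 0 else z), min (t + 1) (k + 1))

/-- The graph: vertex `Nat.pair j p` is the node `p` of level `j`. -/
def gph (k : ℕ) (R : ℕ → Prop) : ColoredGraph where
  G := Set.univ
  L := {l | l ≤ k + 1}
  C := Set.univ
  V v := min v.unpair.1 (k + 1)
  E v w := if v.unpair.1 = w.unpair.1 + 1 ∧ v.unpair.2.unpair.1 = w.unpair.2 ∧
      (v.unpair.1 = k → R v.unpair.2) then {0, 1} else {1}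
  gam _ := {0, 1}
  V_mem := by intro v _; simp
  E_sub := by intros; simp
  gam_sub := by intros; simp
  E_allowed := by
    intro v _ w _
    split_ifs <;> simp

/-- The machine. -/
def mach (k : ℕ) (R : ℕ → Prop) : GraphMachine where
  graph := gph k R
  A := {0, 1}
  zero_mem := by simp
  one_mem := by simp
  S := Set.univ
  s := 0
  alpha _ := Finset.range (k + 2)
  T l c z t := if c ⊆ {0, 1} ∧ t < k + 2 then Tm k l (0 ∈ c) (1 ∈ c) z t else (c, z, t)
  alpha_sub := by intros; simp
  s_mem := by intros; simp
  T_trivial := by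
    intro l c z t h
    rw [if_neg]
    rintro ⟨h1, h2⟩
    rcases h with h | h
    · exact h h1
    · exact h (by simpa using h2)
  T_compat := by
    intro l c z t ht hc hz
    have ht' : t < k + 2 := by simpa using ht
    have hc' : c ⊆ ({0, 1} : Finset ℕ) := hc
    rw [if_pos ⟨hc', ht'⟩]
    show _ ⊆ ({0, 1} : Finset ℕ) ∧ _ ∧ _
    have hz' : z = 0 ∨ z = 1 := by simpa using hz
    unfold Tm
    split_ifs <;> simp [hz']
  T_init := by
    intro l
    simp [Tm]

section run
variable {k : ℕ} {R : ℕ → Prop} {x : ℕ → ℕ}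

theorem mach_T (l : ℕ) (c : Finset ℕ) (z t : ℕ) : (mach k R).T l c z t =
    if c ⊆ {0, 1} ∧ t < k + 2 then Tm k l (0 ∈ c) (1 ∈ c) z t else (c, z, t) := rfl

theorem pulses_sub (g : Config) (v : ℕ) : (mach k R).pulses g v ⊆ {0, 1} :=
  Finset.filter_subset _ _

theorem mem_pulses0 (g : Config) (v : ℕ) : 0 ∈ (mach k R).pulses g v ↔
    ∃ w : ℕ, (w.unpair.1 = v.unpair.1 + 1 ∧ w.unpair.2.unpair.1 = v.unpair.2 ∧
      (w.unpair.1 = k → R w.unpair.2)) ∧ 0 ∈ (g w).1 := by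
  simp only [GraphMachine.pulses, mach, gph, Finset.mem_filter, Set.mem_univ, true_and]
  constructor
  · rintro ⟨_, w, h, h'⟩
    refine ⟨w, ?_, h'⟩
    by_contra hc
    rw [if_neg hc] at h
    simp at h
  · rintro ⟨w, h, h'⟩
    refine ⟨by simp, w, ?_, h'⟩
    rw [if_pos h]
    simp

theorem mem_pulses1 (g : Config) (v : ℕ) : 1 ∈ (mach k R).pulses g v ↔
    ∃ w : ℕ, 1 ∈ (g w).1 := by
  simp only [GraphMachine.pulses, mach, gph, Finset.mem_filter, Set.mem_univ, true_and]
  constructor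
  · rintro ⟨_, w, h, h'⟩
    exact ⟨w, h'⟩
  · rintro ⟨w, h'⟩
    refine ⟨by simp, w, ?_, h'⟩
    split_ifs <;> simp

theorem step_eq (g : Config) (v : ℕ) (ht : (g v).2.2 < k + 2) : (mach k R).step g v =
    Tm k (min v.unpair.1 (k + 1)) (0 ∈ (mach k R).pulses g v) (1 ∈ (mach k R).pulses g v)
      (g v).2.1 (g v).2.2 := by
  unfold GraphMachine.step
  rw [mach_T, if_pos ⟨pulses_sub _ _, ht⟩]
  rfl

theorem run_one (v : ℕ) : (mach k R).run ((mach k R).start x) 1 v =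
    (if x v = 0 then ∅ else {1}, 0, 0) := by
  show (mach k R).step ((mach k R).start x) v = _
  rw [step_eq _ _ (by simp [GraphMachine.start, mach])]
  have h1 : ¬ 1 ∈ (mach k R).pulses ((mach k R).start x) v := by
    rw [mem_pulses1]; simp [GraphMachine.start]
  show Tm k _ _ _ (x v) 0 = _
  by_cases h : x v = 0 <;> simp [Tm, h, h1]

theorem run_two (hx : ∃ v, x v ≠ 0) (v : ℕ) : (mach (k + 1) R).run ((mach (k + 1) R).start x) 2 v =
    (if v.unpair.1 = k + 1 then {0} else ∅, 0, 1) := by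
  show (mach (k + 1) R).step ((mach (k + 1) R).run ((mach (k + 1) R).start x) 1) v = _
  have h1 : 1 ∈ (mach (k + 1) R).pulses ((mach (k + 1) R).run ((mach (k + 1) R).start x) 1) v := by
    rw [mem_pulses1]
    obtain ⟨w, hw⟩ := hx
    exact ⟨w, by simp [run_one, hw]⟩
  have h0 : ¬ 0 ∈ (mach (k + 1) R).pulses ((mach (k + 1) R).run ((mach (k + 1) R).start x) 1) v := by
    rw [mem_pulses0]
    rintro ⟨w, _, hw⟩
    rw [run_one] at hw
    by_cases h : x w = 0 <;> simp [h] at hw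
  rw [step_eq _ _ (by simp [run_one])]
  simp only [Tm, h0, h1, run_one]
  have e : min v.unpair.1 (k + 1 + 1) = k + 1 ↔ v.unpair.1 = k + 1 := by omega
  simp [e]
  omega

theorem run_main (F : ℕ → ℕ → Prop) (hF : ∀ j < k + 1, ∀ p, F j p ↔ ¬ ∃ a, F (j + 1) (Nat.pair p a))
    (hR : F (k + 1) = R) (hx : ∃ v, x v ≠ 0) (s : ℕ) (hs : s ≤ k + 1) (v : ℕ) :
    (mach (k + 1) R).run ((mach (k + 1) R).start x) (s + 2) v =
    (if s + v.unpair.1 = k + 1 ∧ (v.unpair.1 = k + 1 ∨ F v.unpair.1 v.unpair.2) then {0} else ∅,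
      if v.unpair.1 = 0 ∧ s = k + 1 ∧ F 0 v.unpair.2 then 1 else 0, s + 1) := by
  induction s generalizing v with
  | zero =>
    rw [run_two hx]
    have e : v.unpair.1 = k + 1 ∧ (v.unpair.1 = k + 1 ∨ F v.unpair.1 v.unpair.2) ↔
      v.unpair.1 = k + 1 := by tauto
    simp [e]
  | succ s ih =>
    have ih := ih (by omega)
    show (mach (k + 1) R).step ((mach (k + 1) R).run ((mach (k + 1) R).start x) (s + 2)) v = _
    generalize (mach (k + 1) R).run ((mach (k + 1) R).start x) (s + 2) = g at ih
    rw [step_eq _ _ (by rw [ih]; simp; omega)]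
    have h0 : s + 1 + v.unpair.1 = k + 1 →
        (0 ∈ (mach (k + 1) R).pulses g v ↔ ¬ F v.unpair.1 v.unpair.2) := by
      intro hv
      rw [hF _ (by omega), not_not, mem_pulses0]
      constructor
      · rintro ⟨w, ⟨h1, h2, h3⟩, h4⟩
        refine ⟨w.unpair.2.unpair.2, ?_⟩
        rw [← h2, Nat.pair_unpair, ← h1]
        rw [ih] at h4
        by_cases hw : w.unpair.1 = k + 1
        · rw [hw, hR]; exact h3 hw
        · by_cases h5 : s + w.unpair.1 = k + 1 ∧ (w.unpair.1 = k + 1 ∨ F w.unpair.1 w.unpair.2)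
          · exact h5.2.resolve_left hw
          · rw [if_neg h5] at h4
            simp at h4
      · rintro ⟨a, ha⟩
        refine ⟨Nat.pair (v.unpair.1 + 1) (Nat.pair v.unpair.2 a), ⟨by simp, by simp, ?_⟩, ?_⟩
        · intro h
          simp at h
          rw [h, hR] at ha
          simpa using ha
        · rw [ih]
          rw [if_pos]
          · simp
          · simp only [Nat.unpair_pair]
            exact ⟨by omega, Or.inr ha⟩
    have e : s + 1 + min v.unpair.1 (k + 1 + 1) = k + 1 ↔ s + 1 + v.unpair.1 = k + 1 := by omega
    have e2 : min v.unpair.1 (k + 1 + 1) = 0 ↔ v.unpair.1 = 0 := by omega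
    have e3 : min (s + 1 + 1) (k + 1 + 1) = s + 1 + 1 := by omega
    have e4 : ¬ s = k + 1 := by omega
    rw [ih]
    simp only [Tm, e, e2, e3, e4]
    by_cases hv : s + 1 + v.unpair.1 = k + 1
    · have hv' : v.unpair.1 ≠ k + 1 := by omega
      simp only [hv, h0 hv, hv', true_and, false_or, not_not, Nat.add_eq_zero_iff, one_ne_zero,
        and_false, false_and, if_false]
      by_cases hz : v.unpair.1 = 0
      · have : s = k := by omega
        simp [hz, this]
      · simp [hz]
    · have : ¬ (v.unpair.1 = 0 ∧ s = k) := by omega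
      simp only [hv, false_and, if_false, Nat.add_eq_zero_iff, one_ne_zero, and_false]
      have : ¬ (v.unpair.1 = 0 ∧ s + 1 = k + 1 ∧ F 0 v.unpair.2) := by
        rintro ⟨h1, h2, -⟩; omega
      rw [if_neg this]

theorem run_final (F : ℕ → ℕ → Prop)
    (hF : ∀ j < k + 1, ∀ p, F j p ↔ ¬ ∃ a, F (j + 1) (Nat.pair p a))
    (hR : F (k + 1) = R) (hx : ∃ v, x v ≠ 0) (i v : ℕ) :
    (mach (k + 1) R).run ((mach (k + 1) R).start x) (i + (k + 4)) v =
    (∅, if v.unpair.1 = 0 ∧ F 0 v.unpair.2 then 1 else 0, k + 2) := by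
  induction i with
  | zero =>
    rw [Nat.zero_add]
    show (mach (k + 1) R).step ((mach (k + 1) R).run ((mach (k + 1) R).start x) (k + 1 + 2)) v = _
    rw [step_eq _ _ (by rw [run_main F hF hR hx _ le_rfl]; simp)]
    have e : ¬ (k + 1 + 1 + min v.unpair.1 (k + 1 + 1) = k + 1) := by omega
    rw [run_main F hF hR hx _ le_rfl]
    simp [Tm, e]
  | succ i ih =>
    rw [show i + 1 + (k + 4) = i + (k + 4) + 1 by omega]
    show (mach (k + 1) R).step ((mach (k + 1) R).run ((mach (k + 1) R).start x) (i + (k + 4))) v = _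
    rw [step_eq _ _ (by rw [ih]; simp)]
    have e : ¬ (k + 2 + min v.unpair.1 (k + 1 + 1) = k + 1) := by omega
    rw [ih]
    simp [Tm, e]

theorem run_zero (hx : ∀ v, x v = 0) (i v : ℕ) :
    (mach k R).run ((mach k R).start x) i v = (∅, 0, 0) := by
  induction i generalizing v with
  | zero => simp [GraphMachine.run, GraphMachine.start, mach, hx]
  | succ i ih =>
    show (mach k R).step ((mach k R).run ((mach k R).start x) i) v = _
    rw [step_eq _ _ (by rw [ih]; simp)]
    have h1 : ¬ 1 ∈ (mach k R).pulses ((mach k R).run ((mach k R).start x) i) v := by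
      rw [mem_pulses1]; simp [ih]
    simp [Tm, ih, h1]

theorem run_all (F : ℕ → ℕ → Prop)
    (hF : ∀ j < k + 1, ∀ p, F j p ↔ ¬ ∃ a, F (j + 1) (Nat.pair p a))
    (hR : F (k + 1) = R) (x : ℕ → ℕ) (i v : ℕ) :
    (mach (k + 1) R).run ((mach (k + 1) R).start x) (i + (k + 4)) v =
    (∅, if (∃ v, x v ≠ 0) ∧ v.unpair.1 = 0 ∧ F 0 v.unpair.2 then 1 else 0,
      if ∃ v, x v ≠ 0 then k + 2 else 0) := by
  by_cases hx : ∃ v, x v ≠ 0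
  · rw [run_final F hF hR hx]; simp [hx]
  · rw [run_zero (by push Not at hx; exact hx)]; simp [hx]

theorem haltsAt (F : ℕ → ℕ → Prop)
    (hF : ∀ j < k + 1, ∀ p, F j p ↔ ¬ ∃ a, F (j + 1) (Nat.pair p a))
    (hR : F (k + 1) = R) (x : ℕ → ℕ) :
    (mach (k + 1) R).HaltsAt ((mach (k + 1) R).start x) (k + 4) := by
  intro v _
  have h0 := run_all F hF hR x 0 v
  have h1 := run_all F hF hR x 1 v
  rw [Nat.zero_add] at h0
  rw [Nat.add_comm 1 (k + 4)] at h1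
  rw [h0, h1]

theorem run_stable {M : GraphMachine} (hG : M.graph.G = Set.univ) {f : Config} {n : ℕ}
    (h : M.HaltsAt f n) (i : ℕ) : M.run f (n + i) = M.run f n := by
  induction i with
  | zero => rfl
  | succ i ih =>
    show M.step (M.run f (n + i)) = _
    rw [ih]
    funext v
    exact h v (by rw [hG]; trivial)

theorem output_eq (F : ℕ → ℕ → Prop)
    (hF : ∀ j < k + 1, ∀ p, F j p ↔ ¬ ∃ a, F (j + 1) (Nat.pair p a))
    (hR : F (k + 1) = R) (x : ℕ → ℕ) (v : ℕ) :
    (mach (k + 1) R).outputAt x v =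
      if (∃ v, x v ≠ 0) ∧ v.unpair.1 = 0 ∧ F 0 v.unpair.2 then 1 else 0 := by
  have hne := haltsAt F hF hR x
  unfold GraphMachine.outputAt
  have hmem := Nat.sInf_mem (s := {n | (mach (k + 1) R).HaltsAt ((mach (k + 1) R).start x) n})
    ⟨_, hne⟩
  have hle := Nat.sInf_le (s := {n | (mach (k + 1) R).HaltsAt ((mach (k + 1) R).start x) n}) hne
  obtain ⟨i, hi⟩ := Nat.exists_eq_add_of_le hle
  rw [← run_stable rfl hmem i, ← hi]
  have := run_all F hF hR x 0 v
  rw [Nat.zero_add] at this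
  rw [this]

end run


/-! ### Computability of the machine -/

section comp
open Encodable

theorem enc_sorted (s : Finset ℕ) : ∃ l : List ℕ, encode s = encode l ∧ l.Pairwise (· ≤ ·) ∧
    (l : Multiset ℕ) = s.val :=
  ⟨Multiset.sort s.val (· ≤ ·), rfl, Multiset.pairwise_sort _ _, Multiset.sort_eq _ _⟩

theorem dec_eq (n : ℕ) : (decode (α := Finset ℕ) n) =
    if h : (Denumerable.ofNat (List ℕ) n).Nodup then
      some ⟨(Denumerable.ofNat (List ℕ) n : Multiset ℕ), h⟩ else none := by
  have h : decode (α := Multiset ℕ) n = some (Denumerable.ofNat (List ℕ) n : Multiset ℕ) := by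
    show _ <$> decode (α := List ℕ) n = _
    rw [Denumerable.decode_eq_ofNat]; rfl
  refine (@Encodable.decode_ofEquiv _ _ (_) _ n).trans ?_
  have key : ∀ D : DecidableEq ℕ, (@decode {s : Multiset ℕ // s.Nodup}
      (@Subtype.encodable _ Multiset.Nodup _ (fun a => @Multiset.nodupDecidable ℕ D a)) n) =
      if h : (Denumerable.ofNat (List ℕ) n).Nodup then
        some ⟨(Denumerable.ofNat (List ℕ) n : Multiset ℕ), h⟩ else none := by
    intro D
    refine (congrArg (fun o => Option.bind o _) h).trans ?_
    by_cases hn : (Denumerable.ofNat (List ℕ) n).Nodup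
    · rw [dif_pos hn]
      exact dif_pos hn
    · rw [dif_neg hn]
      exact dif_neg hn
  rw [key]
  split_ifs <;> rfl

/-- The decoded finite set. -/
def decF (n : ℕ) : Finset ℕ := (decode (α := Finset ℕ) n).getD ∅

/-- Sorted list of elements of the list coded by `n`. -/
def srt (n : ℕ) : List ℕ :=
  (List.range (n + 1)).filter (fun a => decide (a ∈ Denumerable.ofNat (List ℕ) n))

theorem mem_le_encode (l : List ℕ) : ∀ a ∈ l, a ≤ encode l := by
  induction l with
  | nil => simp
  | cons b l ih =>
    intro a ha
    rw [encode_list_cons]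
    rcases List.mem_cons.1 ha with rfl | h
    · exact (Nat.left_le_pair _ _).trans (Nat.le_succ _)
    · exact (ih a h).trans ((Nat.right_le_pair _ _).trans (Nat.le_succ _))

theorem mem_srt (n a : ℕ) : a ∈ srt n ↔ a ∈ Denumerable.ofNat (List ℕ) n := by
  unfold srt
  simp only [List.mem_filter, List.mem_range, decide_eq_true_eq, and_iff_right_iff_imp]
  intro h
  have := mem_le_encode _ _ h
  rw [Denumerable.encode_ofNat] at this
  omega

theorem srt_nodup (n : ℕ) : (srt n).Nodup := List.nodup_range.filter _

theorem srt_sorted (n : ℕ) : (srt n).Pairwise (· ≤ ·) :=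
  (List.pairwise_le_range).filter _

theorem len_iff (n : ℕ) : (srt n).length = (Denumerable.ofNat (List ℕ) n).length ↔
    (Denumerable.ofNat (List ℕ) n).Nodup := by
  have hs : (srt n) ⊆ Denumerable.ofNat (List ℕ) n := fun a h => (mem_srt n a).1 h
  have hp := List.subperm_of_subset (srt_nodup n) hs
  constructor
  · intro h
    exact (hp.perm_of_length_le h.ge).nodup_iff.1 (srt_nodup n)
  · intro h
    refine le_antisymm hp.length_le ?_
    exact (List.subperm_of_subset h (fun a h => (mem_srt n a).2 h)).length_le

theorem encode_list_of (s : Finset ℕ) (l : List ℕ) (h1 : l.Pairwise (· ≤ ·))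
    (h2 : (l : Multiset ℕ) = s.val) : encode s = encode l := by
  obtain ⟨l', h, h1', h2'⟩ := enc_sorted s
  rw [h]
  have hp : l'.Perm l := Multiset.coe_eq_coe.1 (h2'.trans h2.symm)
  rw [List.Perm.eq_of_pairwise (le := (· ≤ ·)) (fun a b _ _ h h' => le_antisymm h h') h1' h1 hp]

theorem encode_decF (n : ℕ) : encode (decF n) =
    if (srt n).length = (Denumerable.ofNat (List ℕ) n).length then encode (srt n)
    else encode (∅ : Finset ℕ) := by
  unfold decF
  rw [dec_eq]
  by_cases h : (Denumerable.ofNat (List ℕ) n).Nodup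
  · rw [dif_pos h, if_pos ((len_iff n).2 h)]
    refine encode_list_of _ _ (srt_sorted n) ?_
    refine Multiset.coe_eq_coe.2 ?_
    exact (List.perm_ext_iff_of_nodup (srt_nodup n) h).2 (mem_srt n)
  · rw [dif_neg h, if_neg (fun h' => h ((len_iff n).1 h'))]
    rfl

theorem mem_list_prim : PrimrecRel (fun (a : ℕ) (l : List ℕ) => a ∈ l) := by
  have : PrimrecRel (fun (l : List ℕ) (a : ℕ) => ∃ b ∈ l, b = a) :=
    PrimrecRel.exists_mem_list Primrec.eq
  refine (this.comp Primrec.snd Primrec.fst).of_eq ?_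
  rintro ⟨a, l⟩
  simp

theorem srt_prim : Primrec srt := by
  have h : PrimrecRel (fun (a n : ℕ) => a ∈ Denumerable.ofNat (List ℕ) n) :=
    mem_list_prim.comp Primrec.fst ((Primrec.ofNat (List ℕ)).comp Primrec.snd)
  have := h.listFilter
  exact (this.comp (Primrec.list_range.comp Primrec.succ) Primrec.id).of_eq (fun n => by
    simp only [srt, id])

theorem encode_decF_prim : Primrec (fun n => encode (decF n)) := by
  refine Primrec.of_eq ?_ (fun n => (encode_decF n).symm)
  refine Primrec.ite ?_ (Primrec.encode.comp srt_prim) (Primrec.const _)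
  exact Primrec.eq.comp (Primrec.list_length.comp srt_prim)
    (Primrec.list_length.comp (Primrec.ofNat (List ℕ)))


/-- Code-level version of the transition table. -/
def Tcode (k l e z t : ℕ) : ℕ :=
  if (e = encode (∅ : Finset ℕ) ∨ e = encode ({0} : Finset ℕ) ∨ e = encode ({1} : Finset ℕ) ∨
      e = encode ({0, 1} : Finset ℕ)) ∧ t < k + 2 then
    (if t = 0 ∧ ¬ (e = encode ({1} : Finset ℕ) ∨ e = encode ({0, 1} : Finset ℕ)) then
      (if z = 0 then Nat.pair (encode (∅ : Finset ℕ)) (Nat.pair 0 0)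
        else Nat.pair (encode ({1} : Finset ℕ)) (Nat.pair 0 0))
    else Nat.pair
      (if t + l = k ∧ ¬ (e = encode ({0} : Finset ℕ) ∨ e = encode ({0, 1} : Finset ℕ))
        then encode ({0} : Finset ℕ) else encode (∅ : Finset ℕ))
      (Nat.pair (if (t + l = k ∧ ¬ (e = encode ({0} : Finset ℕ) ∨ e = encode ({0, 1} : Finset ℕ)))
        ∧ l = 0 then 1 else if t = 0 then 0 else z) (min (t + 1) (k + 1))))
  else Nat.pair e (Nat.pair z t)

theorem sub_iff (c : Finset ℕ) : c ⊆ {0, 1} ↔ c = ∅ ∨ c = {0} ∨ c = {1} ∨ c = {0, 1} := by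
  constructor
  · intro h
    have := Finset.mem_powerset.2 h
    have h2 : (({0, 1} : Finset ℕ).powerset) = {∅, {0}, {1}, {0, 1}} := by decide
    rw [h2] at this
    simpa using this
  · rintro (rfl | rfl | rfl | rfl) <;> simp

theorem encode_T (k : ℕ) (R : ℕ → Prop) (l : ℕ) (c : Finset ℕ) (z t : ℕ) :
    encode ((mach k R).T l c z t) = Tcode k l (encode c) z t := by
  rw [mach_T]
  unfold Tcode
  simp only [encode_inj, sub_iff]
  by_cases h : (c = ∅ ∨ c = {0} ∨ c = {1} ∨ c = {0, 1}) ∧ t < k + 2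
  · rw [if_pos h, if_pos h]
    have h0 : (c = {0} ∨ c = {0, 1}) = (0 ∈ c) := by
      rcases h.1 with rfl | rfl | rfl | rfl <;> simp <;> decide
    have h1 : (c = {1} ∨ c = {0, 1}) = (1 ∈ c) := by
      rcases h.1 with rfl | rfl | rfl | rfl <;> simp <;> decide
    simp only [h0, h1]
    unfold Tm
    by_cases ha : t = 0 ∧ ¬ 1 ∈ c
    · rw [if_pos ha, if_pos ha]
      by_cases hz : z = 0 <;> simp [hz, encode_prod_val]
    · rw [if_neg ha, if_neg ha]
      rw [encode_prod_val, encode_prod_val]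
      by_cases hb : t + l = k ∧ ¬ 0 ∈ c <;> simp [hb]
  · rw [if_neg h, if_neg h]
    rfl

theorem Tcode_prim (k : ℕ) : Primrec (fun q : ℕ × ℕ × ℕ × ℕ =>
    Tcode k q.1 (encode (decF q.2.1)) q.2.2.1 q.2.2.2) := by
  have hl : Primrec (fun q : ℕ × ℕ × ℕ × ℕ => q.1) := Primrec.fst
  have he : Primrec (fun q : ℕ × ℕ × ℕ × ℕ => encode (decF q.2.1)) :=
    encode_decF_prim.comp (Primrec.fst.comp Primrec.snd)
  have hz : Primrec (fun q : ℕ × ℕ × ℕ × ℕ => q.2.2.1) :=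
    Primrec.fst.comp (Primrec.snd.comp Primrec.snd)
  have ht : Primrec (fun q : ℕ × ℕ × ℕ × ℕ => q.2.2.2) :=
    Primrec.snd.comp (Primrec.snd.comp Primrec.snd)
  have hE : ∀ c : Finset ℕ, PrimrecPred (fun q : ℕ × ℕ × ℕ × ℕ =>
      encode (decF q.2.1) = encode c) := fun c => Primrec.eq.comp he (Primrec.const _)
  have ht0 : PrimrecPred (fun q : ℕ × ℕ × ℕ × ℕ => q.2.2.2 = 0) :=
    Primrec.eq.comp ht (Primrec.const _)
  have hz0 : PrimrecPred (fun q : ℕ × ℕ × ℕ × ℕ => q.2.2.1 = 0) :=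
    Primrec.eq.comp hz (Primrec.const _)
  have hl0 : PrimrecPred (fun q : ℕ × ℕ × ℕ × ℕ => q.1 = 0) :=
    Primrec.eq.comp hl (Primrec.const _)
  have hb : PrimrecPred (fun q : ℕ × ℕ × ℕ × ℕ => q.2.2.2 + q.1 = k ∧
      ¬ (encode (decF q.2.1) = encode ({0} : Finset ℕ) ∨
        encode (decF q.2.1) = encode ({0, 1} : Finset ℕ))) :=
    (PrimrecRel.comp Primrec.eq (Primrec.nat_add.comp ht hl) (Primrec.const _)).and
      ((hE _).or (hE _)).not
  unfold Tcode
  refine Primrec.ite ?_ (Primrec.ite ?_ (Primrec.ite hz0 (Primrec.const _) (Primrec.const _)) ?_) ?_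
  · exact ((hE _).or ((hE _).or ((hE _).or (hE _)))).and
      (Primrec.nat_lt.comp ht (Primrec.const _))
  · exact ht0.and ((hE _).or (hE _)).not
  · refine Primrec₂.natPair.comp (Primrec.ite hb (Primrec.const _) (Primrec.const _))
      (Primrec₂.natPair.comp (Primrec.ite (hb.and hl0) (Primrec.const _)
        (Primrec.ite ht0 (Primrec.const _) hz)) ?_)
    exact Primrec.nat_min.comp (Primrec.succ.comp ht) (Primrec.const _)
  · exact Primrec₂.natPair.comp he (Primrec₂.natPair.comp hz ht)

theorem comp_ite {α : Type} [Primcodable α] {P : α → Prop} (h : ComputablePred P) (a b : ℕ) :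
    Computable (fun x => if P x then a else b) := by
  obtain ⟨g, hg, rfl⟩ := ComputablePred.computable_iff.1 h
  refine (Computable.cond hg (Computable.const a) (Computable.const b)).of_eq (fun x => ?_)
  cases hx : g x <;> simp [hx]

theorem cp_true {α : Type} [Primcodable α] : ComputablePred (fun _ : α => True) :=
  cp_of_prim (PrimrecPred.of_eq (p := fun _ : α => (0 : ℕ) = 0)
    (Primrec.eq.comp (Primrec.const _) (Primrec.const _)) (by simp))

theorem mach_comp (k : ℕ) {R : ℕ → Prop} (hR : ComputablePred R) : (mach k R).Computable' := by
  have hu : ComputablePred (· ∈ (Set.univ : Set ℕ)) := by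
    simpa using (cp_true (α := ℕ))
  refine ⟨⟨hu, ?_, hu, ?_, ?_, Computable.const _⟩, hu, Computable.const _, ?_⟩
  · exact cp_of_prim (Primrec.nat_le.comp Primrec.id (Primrec.const _))
  · exact (Primrec.nat_min.comp (Primrec.fst.comp Primrec.unpair) (Primrec.const _)).to_comp
  · have hv1 : Primrec (fun p : ℕ × ℕ => p.1.unpair.1) :=
      Primrec.fst.comp (Primrec.unpair.comp Primrec.fst)
    have hv2 : Primrec (fun p : ℕ × ℕ => p.1.unpair.2) :=
      Primrec.snd.comp (Primrec.unpair.comp Primrec.fst)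
    have hw1 : Primrec (fun p : ℕ × ℕ => p.2.unpair.1) :=
      Primrec.fst.comp (Primrec.unpair.comp Primrec.snd)
    have hw2 : Primrec (fun p : ℕ × ℕ => p.2.unpair.2) :=
      Primrec.snd.comp (Primrec.unpair.comp Primrec.snd)
    have hc : ComputablePred (fun p : ℕ × ℕ => p.1.unpair.1 = p.2.unpair.1 + 1 ∧
        p.1.unpair.2.unpair.1 = p.2.unpair.2 ∧ (¬ p.1.unpair.1 = k ∨ R p.1.unpair.2)) := by
      refine cp_and (cp_of_prim ?_) (cp_and (cp_of_prim ?_) (cp_or (cp_not (cp_of_prim ?_)) ?_))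
      · exact PrimrecRel.comp Primrec.eq hv1 (Primrec.succ.comp hw1)
      · exact PrimrecRel.comp Primrec.eq (Primrec.fst.comp (Primrec.unpair.comp hv2)) hw2
      · exact PrimrecRel.comp Primrec.eq hv1 (Primrec.const _)
      · exact cp_comp hR hv2.to_comp
    refine (comp_ite hc (encode ({0, 1} : Finset ℕ)) (encode ({1} : Finset ℕ))).of_eq ?_
    intro p
    simp only [mach, gph, imp_iff_not_or]
    split_ifs <;> rfl
  · refine (Tcode_prim k).to_comp.of_eq ?_
    intro q
    exact (encode_T k R q.1 (decF q.2.1) q.2.2.1 q.2.2.2).symm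

end comp

theorem zeta_le {X : Set ℕ} {k : ℕ} {R : ℕ → Prop} {ζ : (ℕ → ℕ) → ℕ → ℕ}
    (H : ∀ x v, ζ x v = if (∃ v, x v ≠ 0) ∧ v.unpair.1 = 0 ∧ v.unpair.2 ∈ X then 1 else 0) :
    TuringEq (zetaFn (mach k R) Set.univ ζ) (charFun X) := by
  constructor
  · have hl : Primrec (fun p : ℕ => Denumerable.ofNat (List ℕ) p.unpair.1) :=
      (Primrec.ofNat (List ℕ)).comp (Primrec.fst.comp Primrec.unpair)
    have hp2 : Primrec (fun p : ℕ => p.unpair.2.unpair) :=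
      Primrec.unpair.comp (Primrec.snd.comp Primrec.unpair)
    have hA : PrimrecPred (fun p : ℕ => ∀ a ∈ Denumerable.ofNat (List ℕ) p.unpair.1,
        a = 0 ∨ a = 1) := by
      have h : PrimrecPred (fun a : ℕ => a = 0 ∨ a = 1) :=
        (Primrec.eq.comp Primrec.id (Primrec.const 0)).or
          (Primrec.eq.comp Primrec.id (Primrec.const 1))
      exact (PrimrecPred.forall_mem_list h).comp hl
    have hB : PrimrecPred (fun p : ℕ => ∃ a ∈ Denumerable.ofNat (List ℕ) p.unpair.1,
        ¬ a = 0) := by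
      have h : PrimrecPred (fun a : ℕ => ¬ a = 0) :=
        PrimrecPred.not (Primrec.eq.comp Primrec.id (Primrec.const 0))
      exact (PrimrecPred.exists_mem_list h).comp hl
    have hC : PrimrecPred (fun p : ℕ => p.unpair.2.unpair.1 = 0) :=
      Primrec.eq.comp (Primrec.fst.comp hp2) (Primrec.const 0)
    refine turingLE_of (h := fun p => p.unpair.2.unpair.2)
      (F := fun p y => if (∀ a ∈ Denumerable.ofNat (List ℕ) p.unpair.1, a = 0 ∨ a = 1) ∧
        (∃ a ∈ Denumerable.ofNat (List ℕ) p.unpair.1, ¬ a = 0) ∧ p.unpair.2.unpair.1 = 0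
        then y else 0) (Primrec.snd.comp hp2).to_comp ?_ ?_
    · have := Primrec.ite ((hA.and (hB.and hC)).comp (Primrec.fst (α := ℕ) (β := ℕ)))
        Primrec.snd (Primrec.const 0)
      exact Primrec.to_comp this
    · intro p
      unfold zetaFn charFun
      rw [H]
      generalize hL : Denumerable.ofNat (List ℕ) p.unpair.1 = l
      have hd : ∀ v, decodeFS p.unpair.1 v = l.getD v 0 := by
        intro v; rw [← hL]; rfl
      have h1 : (∀ v ∈ (Set.univ : Set ℕ), decodeFS p.unpair.1 v ∈ (mach k R).A) ↔
          ∀ a ∈ l, a = 0 ∨ a = 1 := by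
        simp only [hd, mach, Set.mem_univ, true_imp_iff, Finset.mem_insert, Finset.mem_singleton]
        constructor
        · intro h a ha
          obtain ⟨i, hi, rfl⟩ := List.getElem_of_mem ha
          have := h i
          rwa [List.getD_eq_getElem _ _ hi] at this
        · intro h v
          by_cases hv : v < l.length
          · rw [List.getD_eq_getElem _ _ hv]
            exact h _ (List.getElem_mem hv)
          · rw [List.getD_eq_default _ _ (by omega)]
            exact Or.inl rfl
      have h2 : (∃ v, decodeFS p.unpair.1 v ≠ 0) ↔ ∃ a ∈ l, ¬ a = 0 := by
        simp only [hd]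
        constructor
        · rintro ⟨v, h⟩
          by_cases hv : v < l.length
          · rw [List.getD_eq_getElem _ _ hv] at h
            exact ⟨_, List.getElem_mem hv, h⟩
          · rw [List.getD_eq_default _ _ (by omega)] at h
            exact absurd rfl h
        · rintro ⟨a, ha, h⟩
          obtain ⟨i, hi, rfl⟩ := List.getElem_of_mem ha
          exact ⟨i, by rwa [List.getD_eq_getElem _ _ hi]⟩
      rw [h1, h2]
      simp only [Set.mem_univ, not_true_eq_false, false_imp_iff, implies_true, true_and, and_true]
      by_cases c1 : ∀ a ∈ l, a = 0 ∨ a = 1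
      · rw [if_pos c1]
        by_cases c2 : ∃ a ∈ l, ¬ a = 0
        · by_cases c3 : p.unpair.2.unpair.1 = 0
          · simp only [c2, c3, true_and, and_true, if_pos c1]
          · rw [if_neg (fun h => c3 h.2.1), if_neg (fun h => c3 h.2.2)]
        · rw [if_neg (fun h => c2 h.1), if_neg (fun h => c2 h.2.1)]
      · rw [if_neg c1, if_neg (fun h => c1 h.1)]
  · refine turingLE_of (h := fun m => Nat.pair (Encodable.encode [1]) (Nat.pair 0 m))
      (F := fun _ y => y) ?_ Primrec.snd.to_comp ?_
    · exact pair_comp (Computable.const _) (pair_comp (Computable.const _) Computable.id)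
    · intro m
      unfold zetaFn charFun
      rw [H]
      have hd : decodeFS (Encodable.encode [1]) = fun v => [1].getD v 0 := by
        funext v
        unfold decodeFS
        rw [Denumerable.ofNat_encode]
      simp only [Nat.unpair_pair, hd]
      have hv : ∀ v, [1].getD v 0 ∈ (mach k R).A := by
        intro v
        cases v <;> simp [mach]
      have he : ∃ v, [1].getD v 0 ≠ 0 := ⟨0, by simp⟩
      have hall : (∀ v ∈ (Set.univ : Set ℕ), [1].getD v 0 ∈ (mach k R).A) ∧
          (∀ v ∉ (Set.univ : Set ℕ), [1].getD v 0 = 0) ∧ Nat.pair 0 m ∈ (Set.univ : Set ℕ) :=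
        ⟨fun v _ => hv v, fun v h => absurd (Set.mem_univ v) h, Set.mem_univ _⟩
      rw [if_pos hall]
      simp only [he, true_and]

/-- If `X ≤_T 𝟎^(n)`, then `X` is Turing equivalent to a function
that is graph computable in constant time by a computable graph machine whose
underlying colored graph is finitary. -/
theorem stmt9 (X : Set ℕ) (n : ℕ) (hX : TuringLE (charFun X) (zeroN n)) :
    ∃ (M : GraphMachine) (X' : Set ℕ) (ζ : (ℕ → ℕ) → ℕ → ℕ) (c : ℕ),
      GraphComputableVia M X' ζ ∧ M.graph.Finitary ∧ M.HaltsWithin c ∧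
      TuringEq (zetaFn M X' ζ) (charFun X) := by
  obtain ⟨k, hk⟩ := arith_of_le (arithFn_zeroN n) hX
  obtain ⟨F, hF0, hFc, hF⟩ := hk.lift.family
  have hhalt := haltsAt F hF rfl
  refine ⟨mach (k + 1) (F (k + 1)), Set.univ, (mach (k + 1) (F (k + 1))).outputAt, k + 4,
    ⟨mach_comp _ hFc, Set.infinite_univ, ?_, fun _ h => h, ?_⟩, ?_, ?_, ?_⟩
  · exact (mach_comp (k + 1) hFc).1.1
  · have hr : ∀ x : ℕ → ℕ, restrictTo Set.univ x = x := by
      intro x; funext v; simp [restrictTo]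
    refine ⟨fun x _ => ⟨k + 4, hhalt x⟩, ?_, ?_, ?_⟩
    · intro x y _ _ h v _
      rw [hr, hr] at h
      rw [h]
    · intro x _ v _ h
      exact absurd (Set.mem_univ v) h
    · intro x _ v _
      rw [hr]
  · exact Set.finite_le_nat _
  · intro A _ _ x _ _
    exact hhalt x
  · refine zeta_le (fun x v => ?_)
    rw [output_eq F hF rfl x v, hF0]

end
end
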